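/- Conservativity of proven lemmas: if φ is an H^g-formula and Σ; P ⊢co φ is provable in CUP, then M(P ∪ {φ}) = M(P); that is, P ∪ {φ} is a conservative extension of P with respect to the complete Herbrand model. -/

import Mathlib

/-! ## Simple types with a single base type `ι` -/

/-- Simple types over the single base type `ι`. -/
inductive Ty : Type
  | base : Ty
  | arrow : Ty → Ty → Ty

/-- The order of a type: `ord ι = 0`, `ord (σ→τ) = max (ord σ + 1) (ord τ)`. -/
def Ty.order : Ty → ℕ
  | .base => 0
  | .arrow σ τ => max (σ.order + 1) τ.order

/-- The arity of a (first-order) type: `ar ι = 0`, `ar (ι→τ) = ar τ + 1`. -/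
def Ty.arity : Ty → ℕ
  | .base => 0
  | .arrow _ τ => τ.arity + 1

/-- A term signature assigns types to (some) constant names. -/
abbrev Sig : Type := String → Option Ty

/-- A signature is first-order if every symbol has a type of order ≤ 1. -/
def Sig.FirstOrder (Sg : Sig) : Prop := ∀ c τ, Sg c = some τ → τ.order ≤ 1

/-- The arity of a symbol of a (first-order) signature. -/
def Sig.ar (Sg : Sig) (c : String) : ℕ := ((Sg c).map Ty.arity).getD 0

/-! ## Terms (de Bruijn representation) -/

/-- Terms of the simply typed λ-calculus with constants and a fixed point
operator `fix`, in de Bruijn representation. -/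
inductive Tm : Type
  | var : ℕ → Tm
  | const : String → Tm
  | app : Tm → Tm → Tm
  | lam : Ty → Tm → Tm
  | fix : Ty → Tm → Tm

/-- Shift ("weakening") of de Bruijn indices `≥ c` by `d`. -/
def Tm.shift (d : ℕ) : ℕ → Tm → Tm
  | c, .var n => if n < c then .var n else .var (n + d)
  | _, .const f => .const f
  | c, .app M N => .app (Tm.shift d c M) (Tm.shift d c N)
  | c, .lam τ M => .lam τ (Tm.shift d (c + 1) M)
  | c, .fix τ M => .fix τ (Tm.shift d (c + 1) M)

/-- Capture-avoiding substitution `Tm.subst k N M = M[N/k]` of the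
de Bruijn variable `k` by `N` in `M`. -/
def Tm.subst : ℕ → Tm → Tm → Tm
  | k, N, .var n => if n = k then Tm.shift k 0 N else if k < n then .var (n - 1) else .var n
  | _, _, .const f => .const f
  | k, N, .app M₁ M₂ => .app (Tm.subst k N M₁) (Tm.subst k N M₂)
  | k, N, .lam τ M => .lam τ (Tm.subst (k + 1) N M)
  | k, N, .fix τ M => .fix τ (Tm.subst (k + 1) N M)

/-- Typing contexts: lists of types (the head is de Bruijn index 0). -/
abbrev Ctx : Type := List Ty

/-- Typing judgement `Γ ⊢ M : τ` over the signature `Sg`. -/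
inductive HasTy (Sg : Sig) : Ctx → Tm → Ty → Prop
  | var {Γ n τ} : Γ[n]? = some τ → HasTy Sg Γ (.var n) τ
  | const {Γ c τ} : Sg c = some τ → HasTy Sg Γ (.const c) τ
  | app {Γ M N σ τ} : HasTy Sg Γ M (.arrow σ τ) → HasTy Sg Γ N σ → HasTy Sg Γ (.app M N) τ
  | lam {Γ M σ τ} : HasTy Sg (σ :: Γ) M τ → HasTy Sg Γ (.lam σ M) (.arrow σ τ)
  | fixI {Γ M τ} : HasTy Sg (τ :: Γ) M τ → HasTy Sg Γ (.fix τ M) τ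

/-- `lams n M` is the `n`-fold λ-abstraction `λ y₁ … yₙ. M` (all of base type). -/
def lams : ℕ → Tm → Tm
  | 0, M => M
  | n + 1, M => .lam .base (lams n M)

/-- `apps M [N₁, …, Nₙ]` is the iterated application `M N₁ … Nₙ`. -/
def apps : Tm → List Tm → Tm
  | M, [] => M
  | M, N :: Ns => apps (.app M N) Ns

/-- Guarded base terms `Γ ⊢g M : τ`. -/
inductive GBase (Sg : Sig) : Ctx → Tm → Ty → Prop
  | var {Γ n τ} : Γ[n]? = some τ → τ.order ≤ 1 → GBase Sg Γ (.var n) τ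
  | const {Γ c τ} : Sg c = some τ → GBase Sg Γ (.const c) τ
  | app {Γ M N σ τ} : GBase Sg Γ M (.arrow σ τ) → GBase Sg Γ N σ → GBase Sg Γ (.app M N) τ
  | fixI {Γ f σf τ Ms} : Sg f = some σf → τ.order ≤ 1 →
      Ms.length = σf.arity →
      (∀ M ∈ Ms, GBase Sg (List.replicate τ.arity Ty.base ++ τ :: Γ) M .base) →
      GBase Sg Γ (.fix τ (lams τ.arity (apps (.const f) Ms))) τ

/-- Guarded terms: generated from closed guarded base terms, constants and
variables by application and λ-abstraction (equivalently: all `fix`-subterms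
occur inside closed guarded base subterms). -/
inductive Guarded (Sg : Sig) : Tm → Prop
  | base {M τ} : GBase Sg [] M τ → Guarded Sg M
  | const {c} : Guarded Sg (.const c)
  | var {n} : Guarded Sg (.var n)
  | app {M N} : Guarded Sg M → Guarded Sg N → Guarded Sg (.app M N)
  | lam {τ M} : Guarded Sg M → Guarded Sg (.lam τ M)

/-! ## Reduction and conversion -/

/-- One-step β/fix-reduction (compatible closure). -/
inductive Red : Tm → Tm → Prop
  | beta {τ M N} : Red (.app (.lam τ M) N) (Tm.subst 0 N M)
  | fixUnfold {τ M} : Red (.fix τ M) (Tm.subst 0 (.fix τ M) M)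
  | appL {M M' N} : Red M M' → Red (.app M N) (.app M' N)
  | appR {M N N'} : Red N N' → Red (.app M N) (.app M N')
  | lam {τ M M'} : Red M M' → Red (.lam τ M) (.lam τ M')
  | fixC {τ M M'} : Red M M' → Red (.fix τ M) (.fix τ M')

/-- Multi-step reduction `↠`. -/
def RedStar : Tm → Tm → Prop := Relation.ReflTransGen Red

/-- Convertibility: equivalence closure of reduction. -/
def Conv : Tm → Tm → Prop := Relation.EqvGen Red
/-! ## Formulae and the logic iFOLm -/

/-- First-order formulae over λ-terms, with atoms `p M₁ … Mₙ` and the later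
modality `▷` (de Bruijn representation for quantifiers). -/
inductive Fm : Type
  | atom : String → List Tm → Fm
  | top : Fm
  | conj : Fm → Fm → Fm
  | disj : Fm → Fm → Fm
  | impl : Fm → Fm → Fm
  | all : Ty → Fm → Fm
  | ex : Ty → Fm → Fm
  | later : Fm → Fm

/-- Shifting of de Bruijn indices in a formula. -/
def Fm.shift (d : ℕ) : ℕ → Fm → Fm
  | c, .atom p Ms => .atom p (Ms.map (Tm.shift d c))
  | _, .top => .top
  | c, .conj φ ψ => .conj (Fm.shift d c φ) (Fm.shift d c ψ)
  | c, .disj φ ψ => .disj (Fm.shift d c φ) (Fm.shift d c ψ)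
  | c, .impl φ ψ => .impl (Fm.shift d c φ) (Fm.shift d c ψ)
  | c, .all τ φ => .all τ (Fm.shift d (c + 1) φ)
  | c, .ex τ φ => .ex τ (Fm.shift d (c + 1) φ)
  | c, .later φ => .later (Fm.shift d c φ)

/-- Substitution `φ[N/k]` of a term for a de Bruijn variable in a formula. -/
def Fm.subst : ℕ → Tm → Fm → Fm
  | k, N, .atom p Ms => .atom p (Ms.map (Tm.subst k N))
  | _, _, .top => .top
  | k, N, .conj φ ψ => .conj (Fm.subst k N φ) (Fm.subst k N ψ)
  | k, N, .disj φ ψ => .disj (Fm.subst k N φ) (Fm.subst k N ψ)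
  | k, N, .impl φ ψ => .impl (Fm.subst k N φ) (Fm.subst k N ψ)
  | k, N, .all τ φ => .all τ (Fm.subst (k + 1) N φ)
  | k, N, .ex τ φ => .ex τ (Fm.subst (k + 1) N φ)
  | k, N, .later φ => .later (Fm.subst k N φ)

/-- Conversion of formulae: congruence closure of term convertibility. -/
inductive FmConv : Fm → Fm → Prop
  | atom {p Ms Ns} : List.Forall₂ Conv Ms Ns → FmConv (.atom p Ms) (.atom p Ns)
  | top : FmConv .top .top
  | conj {φ φ' ψ ψ'} : FmConv φ φ' → FmConv ψ ψ' → FmConv (.conj φ ψ) (.conj φ' ψ')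
  | disj {φ φ' ψ ψ'} : FmConv φ φ' → FmConv ψ ψ' → FmConv (.disj φ ψ) (.disj φ' ψ')
  | impl {φ φ' ψ ψ'} : FmConv φ φ' → FmConv ψ ψ' → FmConv (.impl φ ψ) (.impl φ' ψ')
  | all {τ φ φ'} : FmConv φ φ' → FmConv (.all τ φ) (.all τ φ')
  | ex {τ φ φ'} : FmConv φ φ' → FmConv (.ex τ φ) (.ex τ φ')
  | later {φ φ'} : FmConv φ φ' → FmConv (.later φ) (.later φ')

/-- The sequent calculus (natural deduction) of the logic `iFOLm`:
intuitionistic first-order logic over guarded terms, extended with the later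
modality `▷` and the rules Next, Mon and Löb.  A sequent `IPrf Sg Γ Δ φ`
corresponds to `Σ; Γ; Δ ⊢ φ`. -/
inductive IPrf (Sg : Sig) : Ctx → Set Fm → Fm → Prop
  | proj {Γ Δ φ} : φ ∈ Δ → IPrf Sg Γ Δ φ
  | conv {Γ Δ φ φ'} : IPrf Sg Γ Δ φ' → FmConv φ φ' → IPrf Sg Γ Δ φ
  | topI {Γ Δ} : IPrf Sg Γ Δ .top
  | andI {Γ Δ φ ψ} : IPrf Sg Γ Δ φ → IPrf Sg Γ Δ ψ → IPrf Sg Γ Δ (.conj φ ψ)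
  | andE1 {Γ Δ φ ψ} : IPrf Sg Γ Δ (.conj φ ψ) → IPrf Sg Γ Δ φ
  | andE2 {Γ Δ φ ψ} : IPrf Sg Γ Δ (.conj φ ψ) → IPrf Sg Γ Δ ψ
  | orI1 {Γ Δ φ ψ} : IPrf Sg Γ Δ φ → IPrf Sg Γ Δ (.disj φ ψ)
  | orI2 {Γ Δ φ ψ} : IPrf Sg Γ Δ ψ → IPrf Sg Γ Δ (.disj φ ψ)
  | orE {Γ Δ φ₁ φ₂ ψ} : IPrf Sg Γ (insert φ₁ Δ) ψ → IPrf Sg Γ (insert φ₂ Δ) ψ →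
      IPrf Sg Γ (insert (.disj φ₁ φ₂) Δ) ψ
  | implI {Γ Δ φ ψ} : IPrf Sg Γ (insert φ Δ) ψ → IPrf Sg Γ Δ (.impl φ ψ)
  | implE {Γ Δ φ ψ} : IPrf Sg Γ Δ (.impl φ ψ) → IPrf Sg Γ Δ φ → IPrf Sg Γ Δ ψ
  | allI {Γ Δ τ φ} : IPrf Sg (τ :: Γ) (Fm.shift 1 0 '' Δ) φ → IPrf Sg Γ Δ (.all τ φ)
  | allE {Γ Δ τ φ M} : IPrf Sg Γ Δ (.all τ φ) → Guarded Sg M → HasTy Sg Γ M τ →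
      IPrf Sg Γ Δ (Fm.subst 0 M φ)
  | exI {Γ Δ τ φ M} : Guarded Sg M → HasTy Sg Γ M τ → IPrf Sg Γ Δ (Fm.subst 0 M φ) →
      IPrf Sg Γ Δ (.ex τ φ)
  | exE {Γ Δ τ φ ψ} :
      IPrf Sg (τ :: Γ) (insert φ (Fm.shift 1 0 '' Δ)) (Fm.shift 1 0 ψ) →
      IPrf Sg Γ (insert (.ex τ φ) Δ) ψ
  | next {Γ Δ φ} : IPrf Sg Γ Δ φ → IPrf Sg Γ Δ (.later φ)
  | mon {Γ Δ φ ψ} : IPrf Sg Γ Δ (.later (.impl φ ψ)) →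
      IPrf Sg Γ Δ (.impl (.later φ) (.later ψ))
  | lob {Γ Δ φ} : IPrf Sg Γ (insert (.later φ) Δ) φ → IPrf Sg Γ Δ φ
/-! ## Coinductive uniform proofs (CUP) -/

/-- Atomic formulae (`⊤` or a predicate applied to terms). -/
def Fm.Atomic : Fm → Prop := fun A => A = .top ∨ ∃ p Ms, A = .atom p Ms

/-- Guarded atoms: atomic formulae all of whose terms are guarded. -/
def GdAtom (Sg : Sig) : Fm → Prop := fun A =>
  A = .top ∨ ∃ p Ms, A = .atom p Ms ∧ ∀ M ∈ Ms, Guarded Sg M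

mutual
/-- Definite clauses (`D`-formulae) of the logic `co-hohh_fix`. -/
inductive IsD (Sg : Sig) : Fm → Prop
  | atom {A} : GdAtom Sg A → IsD Sg A
  | impl {G D} : IsG Sg G → IsD Sg D → IsD Sg (.impl G D)
  | conj {D₁ D₂} : IsD Sg D₁ → IsD Sg D₂ → IsD Sg (.conj D₁ D₂)
  | all {τ D} : IsD Sg D → IsD Sg (.all τ D)

/-- Goal formulae (`G`-formulae) of the logic `co-hohh_fix`. -/
inductive IsG (Sg : Sig) : Fm → Prop
  | atom {A} : GdAtom Sg A → IsG Sg A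
  | conj {G₁ G₂} : IsG Sg G₁ → IsG Sg G₂ → IsG Sg (.conj G₁ G₂)
  | disj {G₁ G₂} : IsG Sg G₁ → IsG Sg G₂ → IsG Sg (.disj G₁ G₂)
  | ex {τ G} : IsG Sg G → IsG Sg (.ex τ G)
  | impl {D G} : IsD Sg D → IsG Sg G → IsG Sg (.impl D G)
  | all {τ G} : IsG Sg G → IsG Sg (.all τ G)
end

mutual
/-- Uniform provability `Σ; P; Δ ⊢ G` (goal-directed proof search);
`P` is the program (plus assumptions added by `→R`), `Δ` the set of
coinduction hypotheses. -/
inductive Uni : Sig → Set Fm → Set Fm → Fm → Prop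
  | decide {Sg P Δ D A} : Fm.Atomic A → D ∈ P ∪ Δ → Foc Sg P Δ D A → Uni Sg P Δ A
  | topR {Sg P Δ} : Uni Sg P Δ .top
  | andR {Sg P Δ G₁ G₂} : Uni Sg P Δ G₁ → Uni Sg P Δ G₂ → Uni Sg P Δ (.conj G₁ G₂)
  | orR1 {Sg P Δ G₁ G₂} : Uni Sg P Δ G₁ → Uni Sg P Δ (.disj G₁ G₂)
  | orR2 {Sg P Δ G₁ G₂} : Uni Sg P Δ G₂ → Uni Sg P Δ (.disj G₁ G₂)
  | implR {Sg P Δ D G} : Uni Sg (insert D P) Δ G → Uni Sg P Δ (.impl D G)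
  | allR {Sg P Δ τ G} (c : String) : Sg c = none →
      Uni (Function.update Sg c (some τ)) P Δ (Fm.subst 0 (.const c) G) →
      Uni Sg P Δ (.all τ G)
  | exR {Sg P Δ τ G N} : GBase Sg [] N τ → Uni Sg P Δ (Fm.subst 0 N G) →
      Uni Sg P Δ (.ex τ G)

/-- Focused (backchaining) provability `Σ; P; Δ; D ⊢ A`. -/
inductive Foc : Sig → Set Fm → Set Fm → Fm → Fm → Prop
  | init {Sg P Δ A A'} : FmConv A A' → Foc Sg P Δ A' A
  | implL {Sg P Δ G D A} : Foc Sg P Δ D A → Uni Sg P Δ G → Foc Sg P Δ (.impl G D) A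
  | andL1 {Sg P Δ D₁ D₂ A} : Foc Sg P Δ D₁ A → Foc Sg P Δ (.conj D₁ D₂) A
  | andL2 {Sg P Δ D₁ D₂ A} : Foc Sg P Δ D₂ A → Foc Sg P Δ (.conj D₁ D₂) A
  | allL {Sg P Δ τ D A N} : GBase Sg [] N τ → Foc Sg P Δ (Fm.subst 0 N D) A →
      Foc Sg P Δ (.all τ D) A
end

/-- Guarded provability `Σ; P; Δ ⊢ ⟨φ⟩`: the guarding modality is decomposed
by `∀R⟨⟩`, `∧R⟨⟩`, `→R⟨⟩` and discharged only by `Decide⟨⟩`, which resolves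
against a clause of the original program `P`. -/
inductive Gua : Sig → Set Fm → Set Fm → Fm → Prop
  | decideG {Sg P Δ D A} : Fm.Atomic A → D ∈ P → Foc Sg P Δ D A → Gua Sg P Δ A
  | allRG {Sg P Δ τ φ} (c : String) : Sg c = none →
      Gua (Function.update Sg c (some τ)) P Δ (Fm.subst 0 (.const c) φ) →
      Gua Sg P Δ (.all τ φ)
  | andRG {Sg P Δ φ₁ φ₂} : Gua Sg P Δ φ₁ → Gua Sg P Δ φ₂ → Gua Sg P Δ (.conj φ₁ φ₂)
  | implRG {Sg P Δ φ₁ φ₂} : Gua Sg P (insert φ₁ Δ) φ₂ → Gua Sg P Δ (.impl φ₁ φ₂)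

/-- Coinductive uniform provability `Σ; P ⊢co φ`: the rule CoFix. -/
def CUP (Sg : Sig) (P : Set Fm) (φ : Fm) : Prop := Gua Sg P {φ} φ

/-! ## Logic programs (sets of Horn clauses) -/

/-- `fix`-freeness of a term. -/
def Tm.NoFix : Tm → Prop
  | .fix _ _ => False
  | .app M N => M.NoFix ∧ N.NoFix
  | .lam _ M => M.NoFix
  | _ => True

/-- Predicate signatures: a predicate name is assigned its list of argument types. -/
abbrev PSig : Type := String → Option (List Ty)

/-- `mkAll n φ = ∀x₁ … ∀xₙ. φ` (all quantifiers over the base type `ι`). -/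
def mkAll : ℕ → Fm → Fm
  | 0, φ => φ
  | n + 1, φ => .all .base (mkAll n φ)

/-- Conjunction of a list of formulae. -/
def mkConj : List Fm → Fm
  | [] => .top
  | [A] => A
  | A :: As => .conj A (mkConj As)

/-- Simple (fix-free) first-order atoms in a context of `n` base-typed variables. -/
def SimpleFOAtom (Sg : Sig) (Pg : PSig) (n : ℕ) (A : Fm) : Prop :=
  ∃ p Ms τs, Pg p = some τs ∧ (∀ τ ∈ τs, τ = Ty.base) ∧ A = .atom p Ms ∧
    List.Forall₂ (fun M τ => Tm.NoFix M ∧ HasTy Sg (List.replicate n .base) M τ) Ms τs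

/-- `H`-formulae (Horn clauses) `∀x⃗. A₁ ∧ … ∧ Aₙ → A₀` with fix-free
first-order atoms. -/
def IsHorn (Sg : Sig) (Pg : PSig) (φ : Fm) : Prop :=
  ∃ n As A₀, (∀ A ∈ As, SimpleFOAtom Sg Pg n A) ∧ SimpleFOAtom Sg Pg n A₀ ∧
    φ = mkAll n (.impl (mkConj As) A₀)

/-- Guarding the body of a clause: place `▷` on each conjunct. -/
def guardConj : Fm → Fm
  | .conj φ ψ => .conj (guardConj φ) (guardConj ψ)
  | .top => .top
  | φ => .later φ

/-- The guarding `⟨φ⟩` of a Horn clause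
`∀x⃗.(A₁ ∧ … ∧ Aₙ) → A₀  ↦  ∀x⃗.(▷A₁ ∧ … ∧ ▷Aₙ) → A₀`. -/
def Fm.guard : Fm → Fm
  | .all τ φ => .all τ (Fm.guard φ)
  | .impl body head => .impl (guardConj body) head
  | φ => φ
/-! ## Coterms and the complete Herbrand base -/

/-- The polynomial functor `X ↦ ⟦Σ⟧(X) + V` of a first-order signature,
with a set `V` of variables. -/
def coSig (Sg : Sig) (V : Type) : PFunctor.{0} where
  A := String ⊕ V
  B := fun a => match a with
    | Sum.inl c => Fin (Sg.ar c)
    | Sum.inr _ => Empty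

/-- Coterms over `Σ` and variables `V`: the final coalgebra (M-type) of
`⟦Σ⟧(-) + V`; `PFunctor.M.dest` is the structure map `root`. -/
def CoTerm (Sg : Sig) (V : Type) : Type := (coSig Sg V).M

/-- Ground coterms: the complete Herbrand universe. -/
abbrev GCoTerm (Sg : Sig) : Type := CoTerm Sg Empty

/-- One step of the substitution coalgebra used to define `csubst`. -/
noncomputable def substStep {Sg : Sig} (θ : ℕ → GCoTerm Sg) :
    (CoTerm Sg ℕ ⊕ GCoTerm Sg) → (coSig Sg Empty).Obj (CoTerm Sg ℕ ⊕ GCoTerm Sg)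
  | Sum.inl t =>
    match PFunctor.M.dest t with
    | ⟨Sum.inl f, k⟩ => ⟨Sum.inl f, fun i => Sum.inl (k i)⟩
    | ⟨Sum.inr v, _⟩ =>
      match PFunctor.M.dest (θ v) with
      | ⟨Sum.inl f, k⟩ => ⟨Sum.inl f, fun i => Sum.inr (k i)⟩
      | ⟨Sum.inr e, _⟩ => e.elim
  | Sum.inr t =>
    match PFunctor.M.dest t with
    | ⟨Sum.inl f, k⟩ => ⟨Sum.inl f, fun i => Sum.inr (k i)⟩
    | ⟨Sum.inr e, _⟩ => e.elim

/-- Substitution of ground coterms for the variables of a coterm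
(the Kleisli structure of the free completely iterative monad). -/
noncomputable def csubst {Sg : Sig} (t : CoTerm Sg ℕ) (θ : ℕ → GCoTerm Sg) : GCoTerm Sg :=
  PFunctor.M.corec (substStep θ) (Sum.inl t)

/-- The complete Herbrand base: atoms `p(t₁, …, tₙ)` over ground coterms. -/
abbrev HBase (Sg : Sig) : Type := String × List (GCoTerm Sg)

/-- A specification of the coterm semantics `⟦-⟧` of (first-order guarded)
terms: it identifies convertible terms and sends a term to the tree determined
by its head normal forms. -/
def SemSpec (Sg : Sig) (sem : Tm → CoTerm Sg ℕ) : Prop :=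
  (∀ M N, Conv M N → sem M = sem N) ∧
  (∀ M f Ns (h : Ns.length = Sg.ar f),
    (∀ N ∈ Ns, Guarded Sg N) →
    RedStar M (apps (.const f) Ns) →
    PFunctor.M.dest (sem M) = ⟨Sum.inl f, fun i => sem (Ns.get (Fin.cast h.symm i))⟩) ∧
  (∀ M x, RedStar M (.var x) →
    PFunctor.M.dest (sem M) = ⟨Sum.inr x, fun e => e.elim⟩)

/-! ## Atoms, Horn clauses and the Herbrand model -/

/-- Syntactic atoms `p M₁ … Mₙ`. -/
structure Atm : Type where
  p : String
  args : List Tm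

/-- The element `⟦A⟧[θ]` of the Herbrand base determined by an atom `A`, the
coterm semantics `sem` of terms and a ground substitution `θ`. -/
noncomputable def Atm.gsem {Sg : Sig} (sem : Tm → CoTerm Sg ℕ) (θ : ℕ → GCoTerm Sg)
    (A : Atm) : HBase Sg :=
  (A.p, A.args.map fun M => csubst (sem M) θ)

/-- A clause `∀x₁ … x_n. A₁ ∧ … ∧ A_q → A₀` (de Bruijn: the variables of the
atoms range over `0, …, n-1`). -/
structure HClause : Type where
  n : ℕ
  body : List Atm
  head : Atm

/-- Well-formedness of a guarded first-order atom in a context of `n`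
base-typed variables. -/
def Atm.WFg (Sg : Sig) (Pg : PSig) (n : ℕ) (A : Atm) : Prop :=
  ∃ τs, Pg A.p = some τs ∧ (∀ τ ∈ τs, τ = Ty.base) ∧
    List.Forall₂ (fun M τ => Guarded Sg M ∧ HasTy Sg (List.replicate n .base) M τ)
      A.args τs

/-- `H^g`-formulae: clauses whose atoms are first-order guarded atoms. -/
def HClause.WFg (Sg : Sig) (Pg : PSig) (C : HClause) : Prop :=
  C.head.WFg Sg Pg C.n ∧ ∀ A ∈ C.body, A.WFg Sg Pg C.n

/-- Well-formedness of a fix-free (simple) first-order atom. -/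
def Atm.WFh (Sg : Sig) (Pg : PSig) (n : ℕ) (A : Atm) : Prop :=
  (∀ M ∈ A.args, Tm.NoFix M) ∧ A.WFg Sg Pg n

/-- `H`-formulae: Horn clauses with fix-free first-order atoms. -/
def HClause.WFh (Sg : Sig) (Pg : PSig) (C : HClause) : Prop :=
  C.head.WFh Sg Pg C.n ∧ ∀ A ∈ C.body, A.WFh Sg Pg C.n

/-- The monotone operator `Φ_P` on interpretations `I ⊆ 𝔅` determined by a
set `P` of clauses. -/
noncomputable def PhiP {Sg : Sig} (P : Set HClause) (sem : Tm → CoTerm Sg ℕ)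
    (I : Set (HBase Sg)) : Set (HBase Sg) :=
  { a | ∃ C ∈ P, ∃ θ : ℕ → GCoTerm Sg,
      a = C.head.gsem sem θ ∧ ∀ B ∈ C.body, B.gsem sem θ ∈ I }

theorem PhiP_mono {Sg : Sig} (P : Set HClause) (sem : Tm → CoTerm Sg ℕ) :
    Monotone (PhiP P sem) := by
  intro I J hIJ a ha
  obtain ⟨C, hC, θ, ha, hb⟩ := ha
  exact ⟨C, hC, θ, ha, fun B hB => hIJ (hb B hB)⟩

/-- The complete Herbrand model `M(P)`: the greatest fixed point of `Φ_P`. -/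
noncomputable def HModel {Sg : Sig} (P : Set HClause) (sem : Tm → CoTerm Sg ℕ) :
    Set (HBase Sg) :=
  OrderHom.gfp ⟨PhiP P sem, PhiP_mono P sem⟩

/-- Extension of an environment by a ground coterm (for a de Bruijn binder). -/
def consEnv {Sg : Sig} (t : GCoTerm Sg) (γ : ℕ → GCoTerm Sg) : ℕ → GCoTerm Sg
  | 0 => t
  | n + 1 => γ n

/-- Interpretation `⟦φ⟧_I` of formulae over a single interpretation
`I ⊆ 𝔅`, as a set of environments. -/
noncomputable def FmSemI {Sg : Sig} (sem : Tm → CoTerm Sg ℕ) (I : Set (HBase Sg)) :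
    Fm → Set (ℕ → GCoTerm Sg)
  | .atom p Ms => {γ | (p, Ms.map fun M => csubst (sem M) γ) ∈ I}
  | .top => Set.univ
  | .conj φ ψ => FmSemI sem I φ ∩ FmSemI sem I ψ
  | .disj φ ψ => FmSemI sem I φ ∪ FmSemI sem I ψ
  | .impl φ ψ => {γ | γ ∈ FmSemI sem I φ → γ ∈ FmSemI sem I ψ}
  | .all _ φ => {γ | ∀ t, consEnv t γ ∈ FmSemI sem I φ}
  | .ex _ φ => {γ | ∃ t, consEnv t γ ∈ FmSemI sem I φ}
  | .later φ => FmSemI sem I φ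

/-- The formula corresponding to an atom. -/
def Atm.toFm (A : Atm) : Fm := .atom A.p A.args

/-- The `H^g`-formula `∀x⃗. A₁ ∧ … ∧ A_q → A₀` corresponding to a clause. -/
def HClause.toFm (C : HClause) : Fm :=
  mkAll C.n (.impl (mkConj (C.body.map Atm.toFm)) C.head.toFm)


/-! ## Simultaneous substitution calculus -/

def upr (ξ : ℕ → ℕ) : ℕ → ℕ
  | 0 => 0
  | n + 1 => ξ n + 1

def Tm.ren : (ℕ → ℕ) → Tm → Tm
  | ξ, .var n => .var (ξ n)
  | _, .const c => .const c
  | ξ, .app M N => .app (Tm.ren ξ M) (Tm.ren ξ N)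
  | ξ, .lam τ M => .lam τ (Tm.ren (upr ξ) M)
  | ξ, .fix τ M => .fix τ (Tm.ren (upr ξ) M)

def scons (N : Tm) (σ : ℕ → Tm) : ℕ → Tm
  | 0 => N
  | n + 1 => σ n

def ups (σ : ℕ → Tm) : ℕ → Tm := scons (.var 0) (fun n => (σ n).ren Nat.succ)

def upk (κ : String → Tm) : String → Tm := fun c => (κ c).ren Nat.succ

/-- Simultaneous substitution of constants and variables. -/
def Tm.gs : (String → Tm) → (ℕ → Tm) → Tm → Tm
  | _, σ, .var n => σ n
  | κ, _, .const c => κ c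
  | κ, σ, .app M N => .app (Tm.gs κ σ M) (Tm.gs κ σ N)
  | κ, σ, .lam τ M => .lam τ (Tm.gs (upk κ) (ups σ) M)
  | κ, σ, .fix τ M => .fix τ (Tm.gs (upk κ) (ups σ) M)

abbrev Tm.sub (σ : ℕ → Tm) (M : Tm) : Tm := Tm.gs Tm.const σ M

theorem upk_const : upk Tm.const = Tm.const := rfl

theorem ren_ren (M : Tm) : ∀ ξ ζ : ℕ → ℕ, (M.ren ξ).ren ζ = M.ren (fun n => ζ (ξ n)) := by
  have h : ∀ ξ ζ : ℕ → ℕ, (fun n => upr ζ (upr ξ n)) = upr (fun n => ζ (ξ n)) := by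
    intro ξ ζ; funext n; cases n <;> rfl
  induction M with
  | var n => intro ξ ζ; rfl
  | const c => intro ξ ζ; rfl
  | app M N ihM ihN => intro ξ ζ; simp [Tm.ren, ihM, ihN]
  | lam τ M ih => intro ξ ζ; simp [Tm.ren, ih, h]
  | fix τ M ih => intro ξ ζ; simp [Tm.ren, ih, h]

theorem ren_gs (M : Tm) : ∀ (κ : String → Tm) (σ : ℕ → Tm) (ξ : ℕ → ℕ),
    (M.gs κ σ).ren ξ = M.gs (fun c => (κ c).ren ξ) (fun n => (σ n).ren ξ) := by
  have h1 : ∀ (σ : ℕ → Tm) (ξ : ℕ → ℕ),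
      (fun n => (ups σ n).ren (upr ξ)) = ups (fun n => (σ n).ren ξ) := by
    intro σ ξ; funext n; cases n
    · rfl
    · simp [ups, scons, ren_ren, upr]
  have h2 : ∀ (κ : String → Tm) (ξ : ℕ → ℕ),
      (fun n => (upk κ n).ren (upr ξ)) = upk (fun n => (κ n).ren ξ) := by
    intro κ ξ; funext n; simp [upk, ren_ren, upr]
  induction M with
  | var n => intros; rfl
  | const c => intros; rfl
  | app M N ihM ihN => intros; simp [Tm.gs, Tm.ren, ihM, ihN]
  | lam τ M ih => intros; simp [Tm.gs, Tm.ren, ih, h1, h2]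
  | fix τ M ih => intros; simp [Tm.gs, Tm.ren, ih, h1, h2]

theorem gs_ren (M : Tm) : ∀ (κ : String → Tm) (σ : ℕ → Tm) (ξ : ℕ → ℕ),
    (M.ren ξ).gs κ σ = M.gs κ (fun n => σ (ξ n)) := by
  have h1 : ∀ (σ : ℕ → Tm) (ξ : ℕ → ℕ),
      (fun n => (ups σ (upr ξ n))) = ups (fun n => σ (ξ n)) := by
    intro σ ξ; funext n; cases n <;> rfl
  induction M with
  | var n => intros; rfl
  | const c => intros; rfl
  | app M N ihM ihN => intros; simp [Tm.gs, Tm.ren, ihM, ihN]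
  | lam τ M ih => intros; simp [Tm.gs, Tm.ren, ih, h1]
  | fix τ M ih => intros; simp [Tm.gs, Tm.ren, ih, h1]

theorem gs_gs (M : Tm) : ∀ (κ κ' : String → Tm) (σ σ' : ℕ → Tm),
    (M.gs κ σ).gs κ' σ' = M.gs (fun c => (κ c).gs κ' σ') (fun n => (σ n).gs κ' σ') := by
  have h1 : ∀ (κ' : String → Tm) (σ σ' : ℕ → Tm),
      (fun n => (ups σ n).gs (upk κ') (ups σ')) = ups (fun n => (σ n).gs κ' σ') := by
    intro κ' σ σ'; funext n; cases n
    · rfl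
    · simp only [ups, scons, gs_ren, ren_gs]; rfl
  have h2 : ∀ (κ κ' : String → Tm) (σ' : ℕ → Tm),
      (fun n => (upk κ n).gs (upk κ') (ups σ')) = upk (fun n => (κ n).gs κ' σ') := by
    intro κ κ' σ'; funext n; simp only [upk, gs_ren, ren_gs]; rfl
  induction M with
  | var n => intros; rfl
  | const c => intros; rfl
  | app M N ihM ihN => intros; simp [Tm.gs, ihM, ihN]
  | lam τ M ih => intros; simp [Tm.gs, ih, h1, h2]
  | fix τ M ih => intros; simp [Tm.gs, ih, h1, h2]

theorem ups_var : ups Tm.var = Tm.var := by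
  funext n; cases n <;> rfl

theorem gs_id (M : Tm) : M.gs Tm.const Tm.var = M := by
  induction M with
  | var n => rfl
  | const c => rfl
  | app M N ihM ihN => simp [Tm.gs, ihM, ihN]
  | lam τ M ih => simp [Tm.gs, upk_const, ups_var, ih]
  | fix τ M ih => simp [Tm.gs, upk_const, ups_var, ih]

theorem tm_sub_sub (M : Tm) (σ σ' : ℕ → Tm) :
    (M.sub σ).sub σ' = M.sub (fun n => (σ n).sub σ') := by
  simp only [Tm.sub, gs_gs]; rfl

theorem ren_eq_sub (M : Tm) (ξ : ℕ → ℕ) : M.ren ξ = M.sub (fun n => .var (ξ n)) := by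
  have := gs_ren M Tm.const Tm.var ξ
  rw [gs_id] at this; exact this

theorem shift_eq (d : ℕ) (M : Tm) : ∀ c, Tm.shift d c M = M.ren (fun n => if n < c then n else n + d) := by
  have h : ∀ c, upr (fun n => if n < c then n else n + d) = fun n => if n < c + 1 then n else n + d := by
    intro c; funext n; cases n
    · simp [upr]
    · simp only [upr]; split_ifs <;> omega
  induction M with
  | var n => intro c; simp only [Tm.shift, Tm.ren]; split_ifs <;> rfl
  | const c => intros; rfl
  | app M N ihM ihN => intros; simp [Tm.shift, Tm.ren, ihM, ihN]
  | lam τ M ih => intros; simp [Tm.shift, Tm.ren, ih, h]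
  | fix τ M ih => intros; simp [Tm.shift, Tm.ren, ih, h]

def sk (k : ℕ) (N : Tm) : ℕ → Tm := fun n =>
  if n = k then N.ren (fun i => i + k) else if k < n then .var (n - 1) else .var n

theorem subst_eq (M : Tm) : ∀ k N, Tm.subst k N M = M.sub (sk k N) := by
  have h : ∀ k N, ups (sk k N) = sk (k + 1) N := by
    intro k N; funext n; cases n with
    | zero => simp [ups, scons, sk]
    | succ n =>
      simp only [ups, scons, sk, Nat.add_right_cancel_iff, Nat.add_lt_add_iff_right]
      split_ifs with h1 h2
      · rw [ren_ren]; rfl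
      · simp only [Tm.ren]; congr 1; omega
      · rfl
  induction M with
  | var n =>
    intro k N; simp only [Tm.subst, Tm.sub, Tm.gs, sk, shift_eq]; simp
  | const c => intros; rfl
  | app M N ihM ihN => intros; simp [Tm.subst, Tm.gs, ihM, ihN]
  | lam τ M ih => intros; simp [Tm.subst, Tm.gs, ih, h, upk_const]
  | fix τ M ih => intros; simp [Tm.subst, Tm.gs, ih, h, upk_const]

theorem sk_zero (N : Tm) : sk 0 N = scons N .var := by
  funext n; cases n with
  | zero => simp [sk, scons, ren_eq_sub, Tm.sub, gs_id]
  | succ n => simp [sk, scons]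

theorem subst_zero (M N : Tm) : Tm.subst 0 N M = M.sub (scons N .var) := by
  rw [subst_eq, sk_zero]

/-- Key commutation of substitution and instantiation. -/
theorem gs_ups_scons (M N : Tm) (κ : String → Tm) (σ : ℕ → Tm) :
    (M.gs (upk κ) (ups σ)).sub (scons N .var) = M.gs κ (scons N σ) := by
  simp only [Tm.sub, gs_gs]
  congr 1
  · funext c; simp only [upk, gs_ren]; exact gs_id _
  · funext n; cases n with
    | zero => rfl
    | succ n => simp only [ups, scons, gs_ren]; exact gs_id _

theorem scons_gs (M N : Tm) (κ : String → Tm) (σ : ℕ → Tm) :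
    (M.sub (scons N .var)).gs κ σ = M.gs κ (scons (N.gs κ σ) σ) := by
  simp only [Tm.sub, gs_gs]
  congr 1
  funext n; cases n <;> rfl

theorem Red.gs {M M' : Tm} (h : Red M M') : ∀ κ σ, Red (M.gs κ σ) (M'.gs κ σ) := by
  induction h with
  | @beta τ M N =>
    intro κ σ
    rw [subst_zero, scons_gs, ← gs_ups_scons, ← subst_zero]; exact Red.beta
  | @fixUnfold τ M =>
    intro κ σ
    rw [subst_zero, scons_gs, ← gs_ups_scons, ← subst_zero]; exact Red.fixUnfold
  | appL _ ih => intro κ σ; exact Red.appL (ih _ _)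
  | appR _ ih => intro κ σ; exact Red.appR (ih _ _)
  | lam _ ih => intro κ σ; exact Red.lam (ih _ _)
  | fixC _ ih => intro κ σ; exact Red.fixC (ih _ _)

theorem Conv.map {f : Tm → Tm} (hf : ∀ M N, Red M N → Red (f M) (f N)) {M N : Tm}
    (h : Conv M N) : Conv (f M) (f N) := by
  induction h with
  | rel _ _ h => exact .rel _ _ (hf _ _ h)
  | refl _ => exact .refl _
  | symm _ _ _ ih => exact .symm _ _ ih
  | trans _ _ _ _ _ ih1 ih2 => exact .trans _ _ _ ih1 ih2

theorem Conv.rfl' {M : Tm} : Conv M M := .refl _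
theorem Conv.sym {M N : Tm} (h : Conv M N) : Conv N M := .symm _ _ h
theorem Conv.tr {M N K : Tm} (h : Conv M N) (h' : Conv N K) : Conv M K := .trans _ _ _ h h'
theorem Conv.ofEq {M N : Tm} (h : M = N) : Conv M N := h ▸ .refl _
theorem Conv.app {M M' N N' : Tm} (h : Conv M M') (h' : Conv N N') :
    Conv (.app M N) (.app M' N') :=
  (h.map (f := fun X => .app X N) fun _ _ => Red.appL).tr
    (h'.map (f := fun X => .app M' X) fun _ _ => Red.appR)
theorem Conv.lam {τ : Ty} {M M' : Tm} (h : Conv M M') : Conv (.lam τ M) (.lam τ M') :=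
  h.map (f := fun X => .lam τ X) fun _ _ => Red.lam
theorem Conv.fix {τ : Ty} {M M' : Tm} (h : Conv M M') : Conv (.fix τ M) (.fix τ M') :=
  h.map (f := fun X => .fix τ X) fun _ _ => Red.fixC
theorem Conv.gs {M M' : Tm} (h : Conv M M') (κ σ) : Conv (M.gs κ σ) (M'.gs κ σ) :=
  h.map (f := fun X => X.gs κ σ) fun _ _ h => h.gs κ σ
theorem Conv.ren {M M' : Tm} (h : Conv M M') (ξ) : Conv (M.ren ξ) (M'.ren ξ) := by
  rw [ren_eq_sub, ren_eq_sub]; exact h.gs _ _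
theorem Conv.beta {τ : Ty} {M N : Tm} : Conv (.app (.lam τ M) N) (M.sub (scons N .var)) := by
  rw [← subst_zero]; exact .rel _ _ .beta
theorem Conv.unfold {τ : Ty} {M : Tm} : Conv (.fix τ M) (M.sub (scons (.fix τ M) .var)) := by
  rw [← subst_zero]; exact .rel _ _ .fixUnfold

theorem conv_sub (M : Tm) : ∀ (σ σ' : ℕ → Tm), (∀ i, Conv (σ i) (σ' i)) →
    Conv (M.sub σ) (M.sub σ') := by
  have h : ∀ (σ σ' : ℕ → Tm), (∀ i, Conv (σ i) (σ' i)) → ∀ i, Conv (ups σ i) (ups σ' i) := by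
    intro σ σ' h i; cases i with
    | zero => exact .refl _
    | succ i => exact (h i).ren _
  induction M with
  | var n => intro σ σ' hh; exact hh n
  | const c => intros; exact .refl _
  | app M N ihM ihN => intro σ σ' hh; exact (ihM _ _ hh).app (ihN _ _ hh)
  | lam τ M ih => intro σ σ' hh; exact (ih _ _ (h _ _ hh)).lam
  | fix τ M ih => intro σ σ' hh; exact (ih _ _ (h _ _ hh)).fix

/-! ## Iterated abstraction and application -/

theorem lams_gs (m : ℕ) (B : Tm) : ∀ κ σ, (lams m B).gs κ σ = lams m (B.gs (upk^[m] κ) (ups^[m] σ)) := by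
  induction m with
  | zero => intros; rfl
  | succ m ih => intro κ σ; simp only [lams, Tm.gs, ih, Function.iterate_succ, Function.comp]

theorem lams_ren (m : ℕ) (B : Tm) : ∀ ξ, (lams m B).ren ξ = lams m (B.ren (upr^[m] ξ)) := by
  induction m with
  | zero => intros; rfl
  | succ m ih => intro ξ; simp only [lams, Tm.ren, ih, Function.iterate_succ, Function.comp]

theorem lams_add (k m : ℕ) (B : Tm) : lams (k + m) B = lams k (lams m B) := by
  induction k with
  | zero => simp [lams]
  | succ k ih => rw [Nat.succ_add]; simp only [lams, ih]

theorem upk_iter_const (m : ℕ) : upk^[m] Tm.const = Tm.const := by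
  induction m with
  | zero => rfl
  | succ m ih => rw [Function.iterate_succ, Function.comp, upk_const, ih]

theorem ups_iter_var (m : ℕ) : ups^[m] Tm.var = Tm.var := by
  induction m with
  | zero => rfl
  | succ m ih => rw [Function.iterate_succ, Function.comp, ups_var, ih]

theorem lams_sub (m : ℕ) (B : Tm) (σ) : (lams m B).sub σ = lams m (B.sub (ups^[m] σ)) := by
  rw [Tm.sub, lams_gs, upk_iter_const]

theorem apps_gs (Ms : List Tm) (κ σ) : ∀ H : Tm, (apps H Ms).gs κ σ = apps (H.gs κ σ) (Ms.map (Tm.gs κ σ)) := by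
  induction Ms with
  | nil => intro H; rfl
  | cons M Ms ih => intro H; simp only [apps, List.map, ih, Tm.gs]

theorem apps_ren (Ms : List Tm) (ξ) : ∀ H : Tm, (apps H Ms).ren ξ = apps (H.ren ξ) (Ms.map (Tm.ren ξ)) := by
  induction Ms with
  | nil => intro H; rfl
  | cons M Ms ih => intro H; simp only [apps, List.map, ih, Tm.ren]

theorem Conv.lams {m : ℕ} {M M' : Tm} (h : Conv M M') : Conv (lams m M) (lams m M') := by
  induction m with
  | zero => exact h
  | succ m ih => exact ih.lam

theorem Conv.apps {Ms Ms' : List Tm} (h : List.Forall₂ Conv Ms Ms') :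
    ∀ {H H' : Tm}, Conv H H' → Conv (apps H Ms) (apps H' Ms') := by
  induction h with
  | nil => intro H H' h; exact h
  | cons h1 _ ih => intro H H' h; exact ih (h.app h1)

/-- `appk k F σ = F (σ (k-1)) … (σ 0)`. -/
def appk : ℕ → Tm → (ℕ → Tm) → Tm
  | 0, F, _ => F
  | k + 1, F, σ => appk k (.app F (σ k)) σ

def lk : ℕ → (ℕ → Tm) → List Tm
  | 0, _ => []
  | k + 1, σ => σ k :: lk k σ

theorem appk_eq_apps (k : ℕ) (σ) : ∀ F, appk k F σ = apps F (lk k σ) := by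
  induction k with
  | zero => intro F; rfl
  | succ k ih => intro F; exact ih _

theorem lk_length (k : ℕ) (σ) : (lk k σ).length = k := by
  induction k with
  | zero => rfl
  | succ k ih => simp [lk, ih]

theorem mem_lk {k : ℕ} {σ M} (h : M ∈ lk k σ) : ∃ i < k, M = σ i := by
  induction k with
  | zero => simp [lk] at h
  | succ k ih =>
    simp only [lk, List.mem_cons] at h
    rcases h with h | h
    · exact ⟨k, by omega, h⟩
    · obtain ⟨i, hi, h⟩ := ih h; exact ⟨i, by omega, h⟩

theorem appk_congr (k : ℕ) (σ σ' : ℕ → Tm) (h : ∀ i < k, σ i = σ' i) :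
    ∀ F, appk k F σ = appk k F σ' := by
  induction k with
  | zero => intro F; rfl
  | succ k ih =>
    intro F; simp only [appk]
    rw [h k (by omega)]; exact ih (fun i hi => h i (by omega)) _

theorem Conv.appk {k : ℕ} {σ σ' : ℕ → Tm} (h : ∀ i < k, Conv (σ i) (σ' i)) :
    ∀ {F F'}, Conv F F' → Conv (appk k F σ) (appk k F' σ') := by
  induction k with
  | zero => intro F F' hF; exact hF
  | succ k ih =>
    intro F F' hF
    exact ih (fun i hi => h i (by omega)) (hF.app (h k (by omega)))

theorem appk_lams (k : ℕ) (B : Tm) (σ : ℕ → Tm) : ∀ s : ℕ → Tm,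
    Conv (appk k ((lams k B).sub s) σ) (B.sub (fun i => if i < k then σ i else s (i - k))) := by
  induction k with
  | zero => intro s; simp only [appk, lams]; apply Conv.ofEq; simp
  | succ k ih =>
    intro s
    have h1 : Conv (.app ((lams (k+1) B).sub s) (σ k)) ((lams k B).sub (scons (σ k) s)) := by
      have := gs_ups_scons (lams k B) (σ k) Tm.const s
      exact Conv.tr Conv.beta (Conv.ofEq this)
    refine Conv.tr (Conv.appk (k := k) (fun i _ => Conv.rfl') h1) ((ih _).tr (Conv.ofEq ?_))
    congr 1
    funext i
    rcases lt_trichotomy i k with h | h | h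
    · rw [if_pos h, if_pos (by omega)]
    · subst h; simp [scons]
    · rw [if_neg (by omega), if_neg (by omega)]
      obtain ⟨j, rfl⟩ := Nat.exists_eq_add_of_lt h
      rw [show k + j + 1 - k = j + 1 by omega, show k + j + 1 - (k + 1) = j by omega]; rfl

theorem appk_lams' (k : ℕ) (B : Tm) (σ : ℕ → Tm) :
    Conv (appk k (lams k B) σ) (B.sub (fun i => if i < k then σ i else .var (i - k))) := by
  have := appk_lams k B σ Tm.var
  rwa [Tm.sub, gs_id] at this


/-! ## Typing -/

abbrev bctx (n : ℕ) : Ctx := List.replicate n Ty.base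

theorem bctx_get {n i : ℕ} {τ : Ty} (h : (bctx n)[i]? = some τ) : i < n ∧ τ = .base := by
  rw [List.getElem?_replicate] at h
  split_ifs at h with hi
  exact ⟨hi, by simpa using h.symm⟩

theorem bctx_get_lt {n i : ℕ} (h : i < n) : (bctx n)[i]? = some Ty.base := by
  rw [List.getElem?_replicate, if_pos h]

theorem order_arrow {σ τ : Ty} (h : (Ty.arrow σ τ).order ≤ 1) : σ = .base ∧ τ.order ≤ 1 := by
  simp only [Ty.order] at h
  refine ⟨?_, by omega⟩
  cases σ with
  | base => rfl
  | arrow a b => simp only [Ty.order] at h; omega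

theorem gs_congr {Sg : Sig} {Γ M τ} (h : HasTy Sg Γ M τ) : ∀ {κ κ' : String → Tm} {σ σ' : ℕ → Tm},
    (∀ c τ, Sg c = some τ → κ c = κ' c) → (∀ i < Γ.length, σ i = σ' i) → M.gs κ σ = M.gs κ' σ' := by
  have hu : ∀ {Γ : Ctx} {τ : Ty} {σ σ' : ℕ → Tm}, (∀ i < Γ.length, σ i = σ' i) →
      ∀ i < (τ :: Γ).length, ups σ i = ups σ' i := by
    intro Γ τ σ σ' h i hi
    cases i with
    | zero => rfl
    | succ i => simp only [ups, scons]; rw [h i (by simpa using hi)]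
  have hk : ∀ {κ κ' : String → Tm}, (∀ c τ, Sg c = some τ → κ c = κ' c) →
      (∀ c τ, Sg c = some τ → upk κ c = upk κ' c) := by
    intro κ κ' h c τ hc; simp only [upk]; rw [h c τ hc]
  induction h with
  | @var Γ n τ h =>
    intro κ κ' σ σ' _ hs
    exact hs _ (by by_contra hh; rw [List.getElem?_eq_none (by omega)] at h; simp at h)
  | const h => intro κ κ' σ σ' hk _; exact hk _ _ h
  | app _ _ ih1 ih2 => intro κ κ' σ σ' a b; simp only [Tm.gs]; rw [ih1 a b, ih2 a b]
  | lam _ ih => intro κ κ' σ σ' a b; simp only [Tm.gs]; rw [ih (hk a) (hu b)]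
  | fixI _ ih => intro κ κ' σ σ' a b; simp only [Tm.gs]; rw [ih (hk a) (hu b)]

theorem HasTy.ren {Sg : Sig} {Γ M τ} (h : HasTy Sg Γ M τ) : ∀ {Γ' : Ctx} {ξ : ℕ → ℕ},
    (∀ i τ, Γ[i]? = some τ → Γ'[ξ i]? = some τ) → HasTy Sg Γ' (M.ren ξ) τ := by
  have hu : ∀ {Γ Γ' : Ctx} {τ : Ty} {ξ : ℕ → ℕ}, (∀ i τ, Γ[i]? = some τ → Γ'[ξ i]? = some τ) →
      (∀ i τ', (τ :: Γ)[i]? = some τ' → (τ :: Γ')[upr ξ i]? = some τ') := by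
    intro Γ Γ' τ ξ h i τ' hi
    cases i with
    | zero => exact hi
    | succ i => simpa [upr] using h i τ' (by simpa using hi)
  induction h with
  | var h => intro Γ' ξ hx; exact .var (hx _ _ h)
  | const h => intro Γ' ξ hx; exact .const h
  | app _ _ ih1 ih2 => intro Γ' ξ hx; exact .app (ih1 hx) (ih2 hx)
  | lam _ ih => intro Γ' ξ hx; exact .lam (ih (hu hx))
  | fixI _ ih => intro Γ' ξ hx; exact .fixI (ih (hu hx))

theorem HasTy.sub {Sg : Sig} {Γ M τ} (h : HasTy Sg Γ M τ) : ∀ {Γ' : Ctx} {s : ℕ → Tm},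
    (∀ i τ, Γ[i]? = some τ → HasTy Sg Γ' (s i) τ) → HasTy Sg Γ' (M.sub s) τ := by
  have hu : ∀ {Γ Γ' : Ctx} {τ : Ty} {s : ℕ → Tm}, (∀ i τ, Γ[i]? = some τ → HasTy Sg Γ' (s i) τ) →
      (∀ i τ', (τ :: Γ)[i]? = some τ' → HasTy Sg (τ :: Γ') (ups s i) τ') := by
    intro Γ Γ' τ ξ h i τ' hi
    cases i with
    | zero => exact .var hi
    | succ i => exact (h i τ' (by simpa using hi)).ren (fun j τ hj => by simpa using hj)
  induction h with
  | var h => intro Γ' ξ hx; exact hx _ _ h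
  | const h => intro Γ' ξ hx; exact .const h
  | app _ _ ih1 ih2 => intro Γ' ξ hx; exact .app (ih1 hx) (ih2 hx)
  | lam _ ih => intro Γ' ξ hx; exact .lam (ih (hu hx))
  | fixI _ ih => intro Γ' ξ hx; exact .fixI (ih (hu hx))

theorem HasTy.weak {Sg : Sig} {M τ} (h : HasTy Sg [] M τ) (Γ : Ctx) : HasTy Sg Γ M τ := by
  have := h.sub (Γ' := Γ) (s := Tm.var) (by simp)
  rwa [Tm.sub, gs_id] at this

theorem sub_closed {Sg : Sig} {M τ} (h : HasTy Sg [] M τ) (σ : ℕ → Tm) : M.sub σ = M := by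
  conv_rhs => rw [← gs_id M]
  exact gs_congr h (fun _ _ _ => rfl) (by simp)

theorem HasTy.unique {Sg : Sig} {Γ M τ} (h : HasTy Sg Γ M τ) : ∀ {τ'}, HasTy Sg Γ M τ' → τ = τ' := by
  induction h with
  | var h => intro τ' h'; cases h' with | var h' => rw [h] at h'; simpa using h'
  | const h => intro τ' h'; cases h' with | const h' => rw [h] at h'; simpa using h'
  | app _ _ ih1 ih2 => intro τ' h'; cases h' with | app a b => have := ih1 a; simp at this; exact this.2
  | lam _ ih => intro τ' h'; cases h' with | lam a => rw [ih a]
  | fixI _ ih => intro τ' h'; cases h' with | fixI a => rfl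

theorem hasTy_apps {Sg : Sig} {Γ} (Ms : List Tm) : ∀ {H τ}, HasTy Sg Γ H τ → τ.order ≤ 1 →
    Ms.length = τ.arity → (∀ M ∈ Ms, HasTy Sg Γ M .base) → HasTy Sg Γ (apps H Ms) .base := by
  induction Ms with
  | nil =>
    intro H τ h _ hl _
    cases τ with
    | base => exact h
    | arrow a b => simp [Ty.arity] at hl
  | cons M Ms ih =>
    intro H τ h ho hl hM
    cases τ with
    | base => simp [Ty.arity] at hl
    | arrow a b =>
      obtain ⟨rfl, ho2⟩ := order_arrow ho
      exact ih (.app h (hM M (by simp))) ho2 (by simpa [Ty.arity] using hl)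
        (fun N hN => hM N (by simp [hN]))

theorem hasTy_lams {Sg : Sig} {Γ : Ctx} {B} : ∀ {τ : Ty}, τ.order ≤ 1 →
    HasTy Sg (bctx τ.arity ++ Γ) B .base → HasTy Sg Γ (lams τ.arity B) τ := by
  intro τ
  induction τ generalizing Γ with
  | base => intro _ h; exact h
  | arrow a b _ ih =>
    intro ho h
    obtain ⟨rfl, ho2⟩ := order_arrow ho
    refine .lam (ih ho2 ?_)
    simpa [Ty.arity, List.replicate_succ', bctx] using h

theorem GBase.order {Sg : Sig} (hSg : Sg.FirstOrder) {Γ M τ} (h : GBase Sg Γ M τ) : τ.order ≤ 1 := by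
  induction h with
  | var _ h => exact h
  | const h => exact hSg _ _ h
  | app _ _ ih _ => exact (order_arrow ih).2
  | fixI _ h _ _ => exact h

theorem GBase.hasTy {Sg : Sig} (hSg : Sg.FirstOrder) {Γ M τ} (h : GBase Sg Γ M τ) : HasTy Sg Γ M τ := by
  induction h with
  | var h _ => exact .var h
  | const h => exact .const h
  | app _ _ ih1 ih2 => exact .app ih1 ih2
  | fixI hf ho hl _ ih => exact .fixI (hasTy_lams ho (hasTy_apps _ (.const hf) (hSg _ _ hf) hl ih))

theorem gbase_appk {Sg : Sig} {Γ} : ∀ {τ : Ty} {H} {σ : ℕ → Tm}, GBase Sg Γ H τ → τ.order ≤ 1 →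
    (∀ i < τ.arity, GBase Sg Γ (σ i) .base) → GBase Sg Γ (appk τ.arity H σ) .base := by
  intro τ
  induction τ with
  | base => intro H σ h _ _; exact h
  | arrow a b _ ih =>
    intro H σ h ho hs
    obtain ⟨rfl, ho2⟩ := order_arrow ho
    exact ih (.app h (hs _ (by simp [Ty.arity]))) ho2 (fun i hi => hs i (by simp only [Ty.arity]; omega))

theorem ctx_upr_iter (m : ℕ) : ∀ {Γ Γ' : Ctx} {ξ : ℕ → ℕ},
    (∀ i τ, Γ[i]? = some τ → Γ'[ξ i]? = some τ) →
    (∀ i τ', (bctx m ++ Γ)[i]? = some τ' → (bctx m ++ Γ')[upr^[m] ξ i]? = some τ') := by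
  induction m with
  | zero => intro Γ Γ' ξ h; simpa using h
  | succ m ih =>
    intro Γ Γ' ξ h i τ' hi
    have := ih (Γ := .base :: Γ) (Γ' := .base :: Γ') (ξ := upr ξ) (by
      intro i τ hi
      cases i with
      | zero => exact hi
      | succ i => simpa [upr] using h i τ (by simpa using hi)) i τ'
    simp only [bctx, List.replicate_succ', List.append_assoc, List.cons_append, List.nil_append] at *
    exact this hi

theorem GBase.ren {Sg : Sig} {Γ M τ} (h : GBase Sg Γ M τ) : ∀ {Γ' : Ctx} {ξ : ℕ → ℕ},
    (∀ i τ, Γ[i]? = some τ → Γ'[ξ i]? = some τ) → GBase Sg Γ' (M.ren ξ) τ := by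
  induction h with
  | var h ho => intro Γ' ξ hx; exact .var (hx _ _ h) ho
  | const h => intro Γ' ξ hx; exact .const h
  | app _ _ ih1 ih2 => intro Γ' ξ hx; exact .app (ih1 hx) (ih2 hx)
  | @fixI Γ f σf τ Ms hf ho hl _ ih =>
    intro Γ' ξ hx
    simp only [Tm.ren, lams_ren, apps_ren]
    refine .fixI hf ho (by simpa using hl) ?_
    intro M hM
    obtain ⟨N, hN, rfl⟩ := List.mem_map.1 hM
    refine ih N hN (ctx_upr_iter _ ?_)
    intro i τ hi
    cases i with
    | zero => exact hi
    | succ i => simpa [upr] using hx i τ (by simpa using hi)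

theorem gb_ups {Sg : Sig} {Γ Γ' : Ctx} {s : ℕ → Tm} {τ : Ty} (ho : τ.order ≤ 1)
    (h : ∀ i τ, Γ[i]? = some τ → GBase Sg Γ' (s i) τ) :
    ∀ i τ', (τ :: Γ)[i]? = some τ' → GBase Sg (τ :: Γ') (ups s i) τ' := by
  intro i τ' hi
  cases i with
  | zero => exact .var hi (by simp at hi; exact hi ▸ ho)
  | succ i => exact (h i τ' (by simpa using hi)).ren (fun j τ hj => by simpa using hj)

theorem gb_ups_iter {Sg : Sig} (m : ℕ) : ∀ {Γ Γ' : Ctx} {s : ℕ → Tm},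
    (∀ i τ, Γ[i]? = some τ → GBase Sg Γ' (s i) τ) →
    ∀ i τ', (bctx m ++ Γ)[i]? = some τ' → GBase Sg (bctx m ++ Γ') (ups^[m] s i) τ' := by
  induction m with
  | zero => intro Γ Γ' s h; simpa using h
  | succ m ih =>
    intro Γ Γ' s h i τ' hi
    have := ih (gb_ups (τ := .base) (by simp [Ty.order]) h) i τ'
    simp only [bctx, List.replicate_succ', List.append_assoc, List.cons_append, List.nil_append] at *
    exact this hi

theorem GBase.sub {Sg : Sig} {Γ M τ} (h : GBase Sg Γ M τ) : ∀ {Γ' : Ctx} {s : ℕ → Tm},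
    (∀ i τ, Γ[i]? = some τ → GBase Sg Γ' (s i) τ) → GBase Sg Γ' (M.sub s) τ := by
  induction h with
  | var h ho => intro Γ' s hx; exact hx _ _ h
  | const h => intro Γ' s hx; exact .const h
  | app _ _ ih1 ih2 => intro Γ' s hx; exact .app (ih1 hx) (ih2 hx)
  | @fixI Γ f σf τ Ms hf ho hl _ ih =>
    intro Γ' s hx
    simp only [Tm.sub, Tm.gs, lams_gs, apps_gs, upk_const, upk_iter_const]
    refine .fixI hf ho (by simpa using hl) ?_
    intro M hM
    obtain ⟨N, hN, rfl⟩ := List.mem_map.1 hM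
    exact ih N hN (gb_ups_iter _ (gb_ups ho hx))

/-! ## Lifting: open guarded base terms are convertible to guarded terms -/

theorem Guarded.sub {Sg : Sig} (hSg : Sg.FirstOrder) {M} (h : Guarded Sg M) : ∀ {s : ℕ → Tm},
    (∀ i, Guarded Sg (s i)) → Guarded Sg (M.sub s) := by
  have hren : ∀ {M}, Guarded Sg M → ∀ ξ, Guarded Sg (M.ren ξ) := by
    intro M h
    induction h with
    | base h =>
      intro ξ
      rw [ren_eq_sub, sub_closed (h.hasTy hSg)]; exact .base h
    | const => intro ξ; exact .const
    | var => intro ξ; exact .var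
    | app _ _ ih1 ih2 => intro ξ; exact .app (ih1 _) (ih2 _)
    | lam _ ih => intro ξ; exact .lam (ih _)
  induction h with
  | base h => intro s _; rw [sub_closed (h.hasTy hSg)]; exact .base h
  | const => intro s _; exact .const
  | var => intro s hs; exact hs _
  | app _ _ ih1 ih2 => intro s hs; exact .app (ih1 hs) (ih2 hs)
  | lam _ ih =>
    intro s hs; refine .lam (ih ?_)
    intro i; cases i with
    | zero => exact .var
    | succ i => exact hren (hs i) _

/-- Guarded typed terms over `n` base variables. -/
def GT (Sg : Sig) (n : ℕ) (τ : Ty) (M : Tm) : Prop := Guarded Sg M ∧ HasTy Sg (bctx n) M τ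

def GTC (Sg : Sig) (n : ℕ) (τ : Ty) (M : Tm) : Prop := ∃ K, Conv M K ∧ GT Sg n τ K

theorem gtc_appk {Sg : Sig} {n : ℕ} {τ : Ty} (k : ℕ) : ∀ {H} {σ : ℕ → Tm},
    GT Sg n ((Ty.arrow .base)^[k] τ) H →
    (∀ i < k, GT Sg n .base (σ i)) → GT Sg n τ (appk k H σ) := by
  induction k with
  | zero => intro H σ h _; exact h
  | succ k ih =>
    intro H σ h hs
    rw [Function.iterate_succ_apply'] at h
    exact ih ⟨.app h.1 (hs k (by omega)).1, .app h.2 (hs k (by omega)).2⟩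
      (fun i hi => hs i (by omega))

theorem arity_iter (k : ℕ) (τ : Ty) : ((Ty.arrow .base)^[k] τ).arity = k + τ.arity := by
  induction k with
  | zero => simp
  | succ k ih => rw [Function.iterate_succ_apply']; simp only [Ty.arity, ih]; omega

theorem order_iter (k : ℕ) (τ : Ty) (h : τ.order ≤ 1) : ((Ty.arrow .base)^[k] τ).order ≤ 1 := by
  induction k with
  | zero => simpa
  | succ k ih => rw [Function.iterate_succ_apply']; simp only [Ty.order]; omega

theorem lift_gbase {Sg : Sig} (hSg : Sg.FirstOrder) {Γ T τ} (h : GBase Sg Γ T τ) :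
    ∀ {k n : ℕ} {σ : ℕ → Tm}, Γ = bctx k → (∀ i < k, GT Sg n .base (σ i)) → GTC Sg n τ (T.sub σ) := by
  induction h with
  | @var Γ i τ h ho =>
    rintro k n σ rfl hs
    obtain ⟨hi, rfl⟩ := bctx_get h
    exact ⟨_, Conv.rfl', hs i hi⟩
  | const h => intro k n σ _ _; exact ⟨_, Conv.rfl', .const, .const h⟩
  | app _ _ ih1 ih2 =>
    intro k n σ hΓ hs
    obtain ⟨K1, c1, g1⟩ := ih1 hΓ hs
    obtain ⟨K2, c2, g2⟩ := ih2 hΓ hs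
    exact ⟨_, c1.app c2, .app g1.1 g2.1, .app g1.2 g2.2⟩
  | @fixI Γ f σf τ Ms hf ho hl hMs _ =>
    rintro k n σ rfl hs
    have hT : GBase Sg (bctx k) (.fix τ (lams τ.arity (apps (.const f) Ms))) τ := .fixI hf ho hl hMs
    have hTt := hT.hasTy hSg
    generalize hTdef : Tm.fix τ (lams τ.arity (apps (.const f) Ms)) = T at *
    let B := (lams τ.arity (apps (.const f) Ms)).sub (scons T .var)
    have hTB : Conv T B := by
      have := Conv.unfold (τ := τ) (M := lams τ.arity (apps (.const f) Ms))
      rwa [hTdef] at this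
    let τ' := (Ty.arrow .base)^[k] τ
    let F := Tm.fix τ' (lams k B)
    have hF : GBase Sg [] F τ' := by
      have e : lams k B = lams τ'.arity (apps (.const f) (Ms.map (Tm.sub (ups^[τ.arity] (scons T .var))))) := by
        rw [arity_iter, lams_add]
        simp only [B, lams_sub, Tm.sub, apps_gs]; rfl
      simp only [F]; rw [e]
      refine .fixI hf (order_iter _ _ ho) (by simpa using hl) ?_
      intro M hM
      obtain ⟨N, hN, rfl⟩ := List.mem_map.1 hM
      have := (hMs N hN).sub (Γ' := bctx τ.arity ++ (bctx k ++ [τ'])) (gb_ups_iter τ.arity (Γ := τ :: bctx k) (Γ' := bctx k ++ [τ']) (s := scons T .var) (by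
        intro i ρ hi
        cases i with
        | zero =>
          simp at hi; subst hi
          have := hT.sub (Γ' := bctx k ++ [τ']) (s := Tm.var) (by
            intro i ρ hi
            obtain ⟨hi', rfl⟩ := bctx_get hi
            exact .var (by rw [List.getElem?_append_left (by simpa using hi')]; exact hi) (by simp [Ty.order]))
          rwa [Tm.sub, gs_id] at this
        | succ i =>
          have hi : (bctx k)[i]? = some ρ := by simpa using hi
          obtain ⟨hi', rfl⟩ := bctx_get hi
          exact .var (by rw [List.getElem?_append_left (by simpa using hi')]; exact hi) (by simp [Ty.order])))
      rw [← List.append_assoc] at this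
      convert this using 2
      rw [arity_iter, Nat.add_comm, List.replicate_add]
    refine ⟨appk k F σ, ?_, gtc_appk k ⟨.base hF, (hF.hasTy hSg).weak _⟩ hs⟩
    apply Conv.sym
    have h1 : Conv F ((lams k B).sub (scons F .var)) := Conv.unfold
    refine (Conv.appk (k := k) (σ := σ) (fun _ _ => Conv.rfl') h1).tr ?_
    refine (appk_lams k B σ _).tr ?_
    refine (hTB.sym.gs _ _).tr (Conv.ofEq ?_)
    refine gs_congr hTt (fun _ _ _ => rfl) ?_
    intro i hi
    have : i < k := by simpa using hi
    simp [this]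


/-! ## Head normalisation of guarded terms (reducibility) -/

def RB (Sg : Sig) (n : ℕ) (M : Tm) : Prop :=
  ∃ K, Conv M K ∧ GT Sg n .base K ∧
    ((∃ i, i < n ∧ K = .var i) ∨ ∃ f Ks, K = apps (.const f) Ks ∧ Ks.length = Sg.ar f ∧
      ∀ N ∈ Ks, GT Sg n .base N)

def RT (Sg : Sig) (n : ℕ) : Ty → Tm → Prop
  | .base, M => RB Sg n M
  | .arrow σ τ, M => ∀ N, RT Sg n σ N → RT Sg n τ (.app M N)

theorem RT.conv {Sg : Sig} {n : ℕ} : ∀ {τ : Ty} {M M'}, Conv M M' → RT Sg n τ M' → RT Sg n τ M := by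
  intro τ
  induction τ with
  | base => rintro M M' c ⟨K, c', h⟩; exact ⟨K, c.tr c', h⟩
  | arrow a b _ ih => intro M M' c h N hN; exact ih (c.app Conv.rfl') (h N hN)

theorem RT.of_appk {Sg : Sig} {n : ℕ} : ∀ {τ : Ty} {M}, τ.order ≤ 1 →
    (∀ σ : ℕ → Tm, (∀ i < τ.arity, RB Sg n (σ i)) → RB Sg n (appk τ.arity M σ)) → RT Sg n τ M := by
  intro τ
  induction τ with
  | base => intro M _ h; exact h Tm.var (by simp [Ty.arity])
  | arrow a b _ ih =>
    intro M ho h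
    obtain ⟨rfl, ho2⟩ := order_arrow ho
    intro N hN
    refine ih ho2 ?_
    intro σ hs
    have := h (fun i => if i = b.arity then N else σ i) (by
      intro i hi
      simp only [Ty.arity] at hi
      by_cases hh : i = b.arity
      · simp only [hh, if_true]; exact hN
      · simpa [hh] using hs i (by omega))
    simp only [Ty.arity, appk, if_true] at this
    rw [appk_congr _ _ σ] at this
    · exact this
    · intro i hi; simp [hi.ne]

theorem guarded_apps {Sg : Sig} (Ms : List Tm) : ∀ {H}, Guarded Sg H → (∀ M ∈ Ms, Guarded Sg M) →
    Guarded Sg (apps H Ms) := by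
  induction Ms with
  | nil => intro H h _; exact h
  | cons M Ms ih => intro H h hM; exact ih (.app h (hM M (by simp))) (fun N hN => hM N (by simp [hN]))

theorem RB.of_apps {Sg : Sig} (hSg : Sg.FirstOrder) {n : ℕ} {f σf Ms} (hf : Sg f = some σf)
    (hl : Ms.length = σf.arity) (hM : ∀ M ∈ Ms, GTC Sg n .base M) : RB Sg n (apps (.const f) Ms) := by
  have : ∃ Ks, List.Forall₂ Conv Ms Ks ∧ ∀ N ∈ Ks, GT Sg n .base N := by
    clear hl
    induction Ms with
    | nil => exact ⟨[], .nil, by simp⟩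
    | cons M Ms ih =>
      obtain ⟨Ks, h1, h2⟩ := ih (fun N hN => hM N (by simp [hN]))
      obtain ⟨K, c, g⟩ := hM M (by simp)
      refine ⟨K :: Ks, .cons c h1, ?_⟩
      intro N hN
      rcases List.mem_cons.1 hN with rfl | hN
      · exact g
      · exact h2 N hN
  obtain ⟨Ks, h1, h2⟩ := this
  have hl' : Ks.length = σf.arity := by rw [← h1.length_eq, hl]
  refine ⟨apps (.const f) Ks, Conv.apps h1 Conv.rfl', ⟨guarded_apps _ .const fun N hN => (h2 N hN).1,
    hasTy_apps _ (.const hf) (hSg _ _ hf) hl' fun N hN => (h2 N hN).2⟩, .inr ⟨f, Ks, rfl, ?_, h2⟩⟩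
  rw [hl', Sig.ar, hf]; rfl

theorem RB.gtc {Sg : Sig} {n : ℕ} {M} (h : RB Sg n M) : GTC Sg n .base M := by
  obtain ⟨K, c, g, _⟩ := h; exact ⟨K, c, g⟩

theorem rt_const {Sg : Sig} (hSg : Sg.FirstOrder) {n : ℕ} {f τ} (hf : Sg f = some τ) :
    RT Sg n τ (.const f) := by
  refine RT.of_appk (hSg _ _ hf) ?_
  intro σ hs
  rw [appk_eq_apps]
  refine RB.of_apps hSg hf (lk_length _ _) ?_
  intro M hM
  obtain ⟨i, hi, rfl⟩ := mem_lk hM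
  exact (hs i hi).gtc

theorem rt_gbase {Sg : Sig} (hSg : Sg.FirstOrder) {n : ℕ} {Γ T τ} (h : GBase Sg Γ T τ) :
    Γ = [] → RT Sg n τ T := by
  induction h with
  | var h _ => rintro rfl; simp at h
  | const h => intro _; exact rt_const hSg h
  | app _ _ ih1 ih2 => intro hΓ; exact ih1 hΓ _ (ih2 hΓ)
  | @fixI Γ f σf τ Ms hf ho hl hMs _ =>
    rintro rfl
    have hT : GBase Sg [] (.fix τ (lams τ.arity (apps (.const f) Ms))) τ := .fixI hf ho hl hMs
    have hTt := hT.hasTy hSg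
    refine RT.of_appk ho ?_
    intro σ hs
    have h1 := Conv.unfold (τ := τ) (M := lams τ.arity (apps (.const f) Ms))
    generalize Tm.fix τ (lams τ.arity (apps (.const f) Ms)) = T at *
    have hK : ∀ i, ∃ K, Conv (σ i) K ∧ (i < τ.arity → GT Sg n .base K) := by
      intro i
      by_cases hi : i < τ.arity
      · obtain ⟨K, c, g⟩ := (hs i hi).gtc; exact ⟨K, c, fun _ => g⟩
      · exact ⟨_, Conv.rfl', fun h => absurd h hi⟩
    choose K hKc hKg using hK
    have h2 := (Conv.appk (k := τ.arity) (σ := σ) (σ' := K) (fun i _ => hKc i) h1).tr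
      (appk_lams τ.arity _ K _)
    refine RT.conv (τ := .base) h2 ?_
    simp only [Tm.sub, apps_gs]
    refine RB.of_apps hSg hf (by simpa using hl) ?_
    intro M hM
    obtain ⟨N, hN, rfl⟩ := List.mem_map.1 hM
    have hNb := hMs N hN
    let e1 : ℕ → Tm := fun i => if i < τ.arity then .var i else T
    have hN1 : GBase Sg (bctx τ.arity) (N.sub e1) .base := by
      refine hNb.sub ?_
      intro i ρ hi
      by_cases h : i < τ.arity
      · rw [List.getElem?_append_left (by simpa using h)] at hi
        obtain ⟨_, rfl⟩ := bctx_get hi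
        simp only [e1, if_pos h]
        exact .var hi (by simp [Ty.order])
      · rw [List.getElem?_append_right (by simpa using h)] at hi
        simp only [e1, if_neg h]
        have h0 : i - (List.replicate τ.arity Ty.base).length = 0 := by
          by_contra hne
          rw [List.getElem?_eq_none (by simp at *; omega)] at hi
          simp at hi
        rw [h0] at hi
        simp at hi; subst hi
        have := hT.sub (Γ' := bctx τ.arity) (s := Tm.var) (by simp)
        rwa [Tm.sub, gs_id] at this
    have := lift_gbase hSg hN1 (k := τ.arity) (n := n) (σ := K) rfl hKg
    rw [tm_sub_sub] at this
    convert this using 1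
    refine gs_congr (hNb.hasTy hSg) (fun _ _ _ => rfl) ?_
    intro i hi
    by_cases h : i < τ.arity
    · simp only [if_pos h, e1]; rfl
    · have : i = τ.arity := by simp at hi; omega
      subst this
      simp only [lt_irrefl, if_false, e1, Nat.sub_self, scons]
      rw [sub_closed hTt]

theorem rt_fund {Sg : Sig} (hSg : Sg.FirstOrder) {n : ℕ} {M} (h : Guarded Sg M) :
    ∀ {Γ τ} {σ : ℕ → Tm}, HasTy Sg Γ M τ → (∀ i τ', Γ[i]? = some τ' → RT Sg n τ' (σ i)) →
      RT Sg n τ (M.sub σ) := by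
  induction h with
  | base h =>
    intro Γ τ σ ht _
    have h0 := h.hasTy hSg
    rw [sub_closed h0, ← (h0.weak Γ).unique ht]
    exact rt_gbase hSg h rfl
  | const => intro Γ τ σ ht _; cases ht with | const h => exact rt_const hSg h
  | var => intro Γ τ σ ht hs; cases ht with | var h => exact hs _ _ h
  | app _ _ ih1 ih2 =>
    intro Γ τ σ ht hs
    cases ht with | app a b => exact ih1 a hs _ (ih2 b hs)
  | @lam τ0 M _ ih =>
    intro Γ τ σ ht hs
    cases ht with
    | lam a =>
      intro N hN
      refine RT.conv ?_ (ih (σ := scons N σ) a ?_)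
      · exact Conv.beta.tr (Conv.ofEq (gs_ups_scons M N Tm.const σ))
      · intro i τ' hi
        cases i with
        | zero => simp at hi; subst hi; exact hN
        | succ i => exact hs i τ' (by simpa using hi)

theorem gt_whnf {Sg : Sig} (hSg : Sg.FirstOrder) {n : ℕ} {M} (h : GT Sg n .base M) : RB Sg n M := by
  have := rt_fund hSg (n := n) h.1 (σ := Tm.var) h.2 (by
    intro i τ' hi
    obtain ⟨hi', rfl⟩ := bctx_get hi
    exact ⟨_, Conv.rfl', ⟨.var, .var hi⟩, .inl ⟨i, hi', rfl⟩⟩)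
  rwa [Tm.sub, gs_id] at this

/-! ## Turning eigenconstants into variables -/

/-- `κ` turns eigenconstants of `Sg'` into variables `< n`. -/
structure Eig (Sg Sg' : Sig) (n : ℕ) (κ : String → Tm) : Prop where
  h : ∀ c τ, Sg' c = some τ → (κ c = .const c ∧ Sg c = some τ) ∨ (∃ i < n, κ c = .var i ∧ τ = .base)
  old : ∀ c τ, Sg c = some τ → κ c = .const c

def GBC (Sg : Sig) (Γ : Ctx) (M : Tm) : Prop := ∃ K, Conv M K ∧ GBase Sg Γ K .base

theorem gbc_appk {Sg : Sig} {Γ} {τ : Ty} {H} {σ : ℕ → Tm} (h : GBase Sg Γ H τ) (ho : τ.order ≤ 1)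
    (hs : ∀ i < τ.arity, GBC Sg Γ (σ i)) : GBC Sg Γ (appk τ.arity H σ) := by
  have hK : ∀ i, ∃ K, Conv (σ i) K ∧ (i < τ.arity → GBase Sg Γ K .base) := by
    intro i
    by_cases hi : i < τ.arity
    · obtain ⟨K, c, g⟩ := hs i hi; exact ⟨K, c, fun _ => g⟩
    · exact ⟨_, Conv.rfl', fun h => absurd h hi⟩
  choose K hKc hKg using hK
  exact ⟨appk τ.arity H K, Conv.appk (fun i _ => hKc i) Conv.rfl', gbase_appk h ho hKg⟩

theorem upk_iter_apply (d : ℕ) (κ : String → Tm) (c : String) :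
    (upk^[d] κ) c = (κ c).ren (fun i => i + d) := by
  induction d generalizing κ with
  | zero => simp [ren_eq_sub, Tm.sub, gs_id]
  | succ d ih =>
    rw [Function.iterate_succ_apply, ih, upk, ren_ren]
    congr 1; funext i; simp; omega

theorem eig_gbase {Sg Sg' : Sig} (hSg' : Sg'.FirstOrder) {n : ℕ} {κ : String → Tm}
    (E : Eig Sg Sg' n κ) {Γ N τ} (h : GBase Sg' Γ N τ) :
    ∀ {σ : ℕ → Tm}, (∀ i < τ.arity, GBC Sg (Γ ++ bctx n) (σ i)) →
      GBC Sg (Γ ++ bctx n) (appk τ.arity (N.gs (upk^[Γ.length] κ) .var) σ) := by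
  induction h with
  | @var Γ i τ h ho =>
    intro σ hs
    refine gbc_appk (.var ?_ ho) ho hs
    rw [List.getElem?_append_left]
    · exact h
    · by_contra hh; rw [List.getElem?_eq_none (by omega)] at h; simp at h
  | @const Γ c τ h =>
    intro σ hs
    refine gbc_appk ?_ (hSg' _ _ h) hs
    simp only [Tm.gs, upk_iter_apply]
    rcases E.h c τ h with ⟨h1, h2⟩ | ⟨i, hi, h1, rfl⟩
    · rw [h1]; exact .const h2
    · rw [h1]
      refine .var ?_ (by simp [Ty.order])
      rw [List.getElem?_append_right (by simp), Nat.add_sub_cancel]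
      exact bctx_get_lt hi
  | @app Γ M N a b hM hN ih1 ih2 =>
    intro σ hs
    obtain ⟨rfl, ho2⟩ := order_arrow (hM.order hSg')
    have hN' := ih2 (σ := Tm.var) (by simp [Ty.arity])
    simp only [Ty.arity, appk] at hN'
    have := ih1 (σ := fun i => if i = b.arity then N.gs (upk^[Γ.length] κ) .var else σ i) (by
      intro i hi
      simp only [Ty.arity] at hi
      by_cases hh : i = b.arity
      · simpa [hh] using hN'
      · simpa [hh] using hs i (by omega))
    simp only [Ty.arity, appk, if_true] at this
    rw [appk_congr _ _ σ] at this
    · exact this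
    · intro i hi; simp [hi.ne]
  | @fixI Γ f σf τ Ms hf ho hl hMs ih =>
    intro σ hs
    simp only [Tm.gs, lams_gs, apps_gs, ups_var, ups_iter_var]
    have e : upk^[τ.arity] (upk (upk^[Γ.length] κ)) =
        upk^[(List.replicate τ.arity Ty.base ++ τ :: Γ).length] κ := by
      rw [← Function.iterate_succ_apply' upk, ← Function.iterate_add_apply]
      simp
    rw [e]
    have ih' : ∀ M ∈ Ms, GBC Sg (bctx τ.arity ++ τ :: (Γ ++ bctx n))
        (M.gs (upk^[(List.replicate τ.arity Ty.base ++ τ :: Γ).length] κ) .var) := by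
      intro M hM
      have := ih M hM (σ := Tm.var) (by simp [Ty.arity])
      simpa only [Ty.arity, appk, List.append_assoc, List.cons_append] using this
    rcases E.h f σf hf with ⟨h1, h2⟩ | ⟨i, hi, h1, rfl⟩
    · have hc : (upk^[(List.replicate τ.arity Ty.base ++ τ :: Γ).length] κ) f = .const f := by
        rw [upk_iter_apply, h1]; rfl
      rw [hc]
      generalize Tm.gs (upk^[(List.replicate τ.arity Ty.base ++ τ :: Γ).length] κ) Tm.var = g at ih' ⊢
      have : ∃ Ks, List.Forall₂ Conv (Ms.map g) Ks ∧
          ∀ N ∈ Ks, GBase Sg (bctx τ.arity ++ τ :: (Γ ++ bctx n)) N .base := by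
        clear hl hMs ih
        induction Ms with
        | nil => exact ⟨[], .nil, by simp⟩
        | cons M Ms ih =>
          obtain ⟨Ks, h1, h2⟩ := ih (fun N hN => ih' N (by simp [hN]))
          obtain ⟨K, c, g⟩ := ih' M (by simp)
          refine ⟨K :: Ks, .cons c h1, ?_⟩
          intro N hN
          rcases List.mem_cons.1 hN with rfl | hN
          · exact g
          · exact h2 N hN
      obtain ⟨Ks, c, g⟩ := this
      have hb : GBase Sg (Γ ++ bctx n) (.fix τ (lams τ.arity (apps (.const f) Ks))) τ :=
        .fixI h2 ho (by rw [← c.length_eq]; simpa using hl) g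
      obtain ⟨K, c', g'⟩ := gbc_appk hb ho hs
      exact ⟨K, (Conv.appk (fun _ _ => Conv.rfl') (Conv.fix (Conv.lams (Conv.apps c Conv.rfl')))).tr c', g'⟩
    · have : Ms = [] := by simpa [Ty.arity] using hl
      subst this
      simp only [List.map, apps, upk_iter_apply, h1, Tm.ren]
      refine ⟨.var (Γ.length + i), ?_, .var ?_ (by simp [Ty.order])⟩
      · refine (Conv.appk (k := τ.arity) (σ := σ) (fun _ _ => Conv.rfl') Conv.unfold).tr ?_
        refine (appk_lams _ _ _ _).tr (Conv.ofEq ?_)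
        simp only [Tm.sub, Tm.gs, List.length_append, List.length_replicate, List.length_cons]
        rw [if_neg (by omega), show i + (τ.arity + (Γ.length + 1)) - τ.arity = (Γ.length + i) + 1 by omega]
        rfl
      · rw [List.getElem?_append_right (by omega), Nat.add_sub_cancel_left]
        exact bctx_get_lt hi

theorem eig_gtc {Sg Sg' : Sig} (hSg : Sg.FirstOrder) (hSg' : Sg'.FirstOrder) {n : ℕ} {κ : String → Tm}
    (E : Eig Sg Sg' n κ) {N} (h : GBase Sg' [] N .base) : GTC Sg n .base (N.gs κ .var) := by
  obtain ⟨K, c, g⟩ := eig_gbase hSg' E h (σ := Tm.var) (by simp [Ty.arity])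
  obtain ⟨K', c', g'⟩ := lift_gbase hSg g (k := n) (n := n) (σ := Tm.var) rfl
    (fun i hi => ⟨.var, .var (bctx_get_lt hi)⟩)
  rw [Tm.sub, gs_id] at c'
  exact ⟨K', c.tr c', g'⟩


/-! ## Semantics of substitution -/

theorem dest_csubst_inl {Sg : Sig} {θ : ℕ → GCoTerm Sg} {t : CoTerm Sg ℕ} {f : String}
    {k : Fin (Sg.ar f) → CoTerm Sg ℕ}
    (h : PFunctor.M.dest t = (⟨Sum.inl f, k⟩ : (coSig Sg ℕ).Obj (CoTerm Sg ℕ))) :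
    PFunctor.M.dest (csubst t θ) =
      (⟨Sum.inl f, fun i : Fin (Sg.ar f) => csubst (k i) θ⟩ : (coSig Sg Empty).Obj (GCoTerm Sg)) := by
  have h1 : substStep θ (Sum.inl t) =
      (⟨Sum.inl f, fun i : Fin (Sg.ar f) => Sum.inl (k i)⟩ :
        (coSig Sg Empty).Obj (CoTerm Sg ℕ ⊕ GCoTerm Sg)) := by
    simp only [substStep]; rw [h]; rfl
  unfold csubst
  rw [PFunctor.M.dest_corec, h1]
  rfl

theorem dest_ground {Sg : Sig} (t : GCoTerm Sg) : ∃ (f : String) (k : Fin (Sg.ar f) → GCoTerm Sg),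
    PFunctor.M.dest t = (⟨Sum.inl f, k⟩ : (coSig Sg Empty).Obj (GCoTerm Sg)) := by
  rcases h : PFunctor.M.dest t with ⟨a, k⟩
  cases a with
  | inl f => exact ⟨f, k, rfl⟩
  | inr e => exact e.elim

theorem corec_inr {Sg : Sig} (θ : ℕ → GCoTerm Sg) (t : GCoTerm Sg) :
    PFunctor.M.corec (substStep θ) (Sum.inr t) = t := by
  refine PFunctor.M.bisim (fun x y => x = PFunctor.M.corec (substStep θ) (Sum.inr y)) ?_ _ _ rfl
  rintro x y rfl
  obtain ⟨f, k, h⟩ := dest_ground y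
  have h1 : substStep θ (Sum.inr y) =
      (⟨Sum.inl f, fun i : Fin (Sg.ar f) => Sum.inr (k i)⟩ :
        (coSig Sg Empty).Obj (CoTerm Sg ℕ ⊕ GCoTerm Sg)) := by
    simp only [substStep]; rw [h]; rfl
  refine ⟨Sum.inl f, _, k, ?_, h, fun i => rfl⟩
  rw [PFunctor.M.dest_corec, h1]
  rfl

theorem csubst_inr {Sg : Sig} {θ : ℕ → GCoTerm Sg} {t : CoTerm Sg ℕ} {v : ℕ}
    (h : PFunctor.M.dest t = (⟨Sum.inr v, fun e => e.elim⟩ : (coSig Sg ℕ).Obj (CoTerm Sg ℕ))) :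
    csubst t θ = θ v := by
  obtain ⟨f, k, hf⟩ := dest_ground (θ v)
  have h1 : substStep θ (Sum.inl t) =
      (⟨Sum.inl f, fun i : Fin (Sg.ar f) => Sum.inr (k i)⟩ :
        (coSig Sg Empty).Obj (CoTerm Sg ℕ ⊕ GCoTerm Sg)) := by
    have e : substStep θ (Sum.inl t) = substStep θ (Sum.inr (θ v)) := by
      simp only [substStep]; rw [h]
    rw [e]; simp only [substStep]; rw [hf]; rfl
  have h2 : PFunctor.M.dest (csubst t θ) = PFunctor.M.dest (θ v) := by
    unfold csubst
    rw [PFunctor.M.dest_corec, h1, hf]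
    refine congrArg (Sigma.mk (Sum.inl f)) ?_
    funext i
    exact corec_inr θ (k i)
  have := congrArg PFunctor.M.mk h2
  exact (PFunctor.M.mk_dest (csubst t θ)).symm.trans (this.trans (PFunctor.M.mk_dest (θ v)))

theorem kl {Sg : Sig} (hSg : Sg.FirstOrder) {sem : Tm → CoTerm Sg ℕ} (hsem : SemSpec Sg sem)
    {n m : ℕ} {σ : ℕ → Tm} (hσ : ∀ i < m, GT Sg n .base (σ i)) (hg : ∀ i, Guarded Sg (σ i))
    (θ : ℕ → GCoTerm Sg) (M : Tm) (hM : GT Sg m .base M) :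
    csubst (sem (M.sub σ)) θ = csubst (sem M) (fun i => csubst (sem (σ i)) θ) := by
  refine PFunctor.M.bisim (fun x y => x = y ∨ ∃ M, GT Sg m .base M ∧ x = csubst (sem (M.sub σ)) θ ∧
    y = csubst (sem M) (fun i => csubst (sem (σ i)) θ)) ?_ _ _ (.inr ⟨M, hM, rfl, rfl⟩)
  clear hM M
  rintro x y (rfl | ⟨M, hM, rfl, rfl⟩)
  · exact ⟨_, _, _, rfl, rfl, fun i => .inl rfl⟩
  · obtain ⟨K, c, g, ⟨i, hi, rfl⟩ | ⟨f, Ks, rfl, hl, hK⟩⟩ := gt_whnf hSg hM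
    · have e1 : sem (M.sub σ) = sem (σ i) := hsem.1 _ _ (c.gs _ _)
      have e2 : csubst (sem M) (fun i => csubst (sem (σ i)) θ) = csubst (sem (σ i)) θ := by
        rw [hsem.1 _ _ c]
        exact csubst_inr (hsem.2.2 _ i .refl)
      rw [e1, e2]
      exact ⟨_, _, _, rfl, rfl, fun i => .inl rfl⟩
    · have c2 : Conv (M.sub σ) (apps (.const f) (Ks.map (Tm.sub σ))) :=
        (c.gs _ _).tr (Conv.ofEq (apps_gs _ _ _ _))
      have d1 := hsem.2.1 _ f Ks hl (fun N hN => (hK N hN).1) .refl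
      have d2 := hsem.2.1 _ f (Ks.map (Tm.sub σ)) (by simpa using hl) (by
        intro N hN
        obtain ⟨N', hN', rfl⟩ := List.mem_map.1 hN
        exact (hK N' hN').1.sub hSg hg) .refl
      rw [hsem.1 _ _ c, hsem.1 _ _ c2]
      refine ⟨Sum.inl f, _, _, dest_csubst_inl d2, dest_csubst_inl d1, ?_⟩
      intro i
      refine .inr ⟨Ks.get (Fin.cast hl.symm i), hK _ (List.get_mem _ _), ?_, rfl⟩
      simp only [List.get_eq_getElem, List.getElem_map]; rfl

theorem kl' {Sg : Sig} (hSg : Sg.FirstOrder) {sem : Tm → CoTerm Sg ℕ} (hsem : SemSpec Sg sem)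
    {n m : ℕ} {σ : ℕ → Tm} (hσ : ∀ i < m, GTC Sg n .base (σ i))
    (θ : ℕ → GCoTerm Sg) (M : Tm) (hM : GT Sg m .base M) :
    csubst (sem (M.sub σ)) θ = csubst (sem M) (fun i => csubst (sem (σ i)) θ) := by
  -- first cut off the irrelevant part of the substitution
  let σ₁ : ℕ → Tm := fun i => if i < m then σ i else .var i
  have hK : ∀ i, ∃ K, Conv (σ₁ i) K ∧ Guarded Sg K ∧ (i < m → GT Sg n .base K) := by
    intro i
    by_cases hi : i < m
    · obtain ⟨K, c, g⟩ := hσ i hi; exact ⟨K, by simpa [σ₁, hi] using c, g.1, fun _ => g⟩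
    · exact ⟨.var i, Conv.ofEq (by simp [σ₁, hi]), .var, fun h => absurd h hi⟩
  choose K hKc hKG hKg using hK
  have e1 : M.sub σ = M.sub σ₁ :=
    gs_congr hM.2 (fun _ _ _ => rfl) (by intro i hi; simp at hi; simp [σ₁, hi])
  rw [e1, hsem.1 _ _ (conv_sub M _ _ hKc), kl hSg hsem hKg hKG θ M hM]
  -- compare the two environments on the variables `< m`
  have key : ∀ θ₁ θ₂ : ℕ → GCoTerm Sg, (∀ i < m, θ₁ i = θ₂ i) → ∀ M, GT Sg m .base M →
      csubst (sem M) θ₁ = csubst (sem M) θ₂ := by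
    intro θ₁ θ₂ he M hM
    refine PFunctor.M.bisim (fun x y => x = y ∨ ∃ M, GT Sg m .base M ∧ x = csubst (sem M) θ₁ ∧
      y = csubst (sem M) θ₂) ?_ _ _ (.inr ⟨M, hM, rfl, rfl⟩)
    clear hM M e1
    rintro x y (rfl | ⟨M, hM, rfl, rfl⟩)
    · exact ⟨_, _, _, rfl, rfl, fun i => .inl rfl⟩
    · obtain ⟨K, c, g, ⟨i, hi, rfl⟩ | ⟨f, Ks, rfl, hl, hK⟩⟩ := gt_whnf hSg hM
      · rw [hsem.1 _ _ c, csubst_inr (hsem.2.2 _ i .refl), csubst_inr (hsem.2.2 _ i .refl), he i hi]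
        exact ⟨_, _, _, rfl, rfl, fun i => .inl rfl⟩
      · have d1 := hsem.2.1 _ f Ks hl (fun N hN => (hK N hN).1) .refl
        rw [hsem.1 _ _ c]
        refine ⟨Sum.inl f, _, _, dest_csubst_inl d1, dest_csubst_inl d1, ?_⟩
        intro i
        exact .inr ⟨Ks.get (Fin.cast hl.symm i), hK _ (List.get_mem _ _), rfl, rfl⟩
  refine key _ _ ?_ M hM
  intro i hi
  have := hsem.1 _ _ (hKc i)
  simp only [σ₁, if_pos hi] at this
  simp only [this]

/-! ## Soundness of uniform proofs for Horn programs -/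

def HG : Fm → Prop
  | .atom _ _ => True
  | .top => True
  | .conj G₁ G₂ => HG G₁ ∧ HG G₂
  | _ => False

def TrG {Sg : Sig} (ev : Tm → GCoTerm Sg) (I : Set (HBase Sg)) : Fm → Prop
  | .atom p Ms => (p, Ms.map ev) ∈ I
  | .conj G₁ G₂ => TrG ev I G₁ ∧ TrG ev I G₂
  | _ => True

inductive TrD {Sg : Sig} (Sg' : Sig) (ev : Tm → GCoTerm Sg) (I J : Set (HBase Sg)) : Fm → Prop
  | atom {p Ms} : (p, Ms.map ev) ∈ J → TrD Sg' ev I J (.atom p Ms)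
  | top : TrD Sg' ev I J .top
  | conj {φ ψ} : TrD Sg' ev I J φ → TrD Sg' ev I J ψ → TrD Sg' ev I J (.conj φ ψ)
  | impl {G D} : HG G → (TrG ev I G → TrD Sg' ev I J D) → TrD Sg' ev I J (.impl G D)
  | all {τ D} : (∀ N, GBase Sg' [] N τ → TrD Sg' ev I J (Fm.subst 0 N D)) → TrD Sg' ev I J (.all τ D)

theorem foc_sound {Sg : Sig} {Sg' : Sig} {ev : Tm → GCoTerm Sg} (hev : ∀ M N, Conv M N → ev M = ev N)
    {I : Set (HBase Sg)} {P Δ : Set Fm} (hP : ∀ D ∈ P ∪ Δ, TrD Sg' ev I I D) {D A : Fm}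
    (h : Foc Sg' P Δ D A) : ∀ J, TrD Sg' ev I J D → Fm.Atomic A → TrG ev J A := by
  refine Foc.rec
    (motive_1 := fun S Q E G _ => S = Sg' → Q = P → E = Δ → HG G → TrG ev I G)
    (motive_2 := fun S Q E D A _ => S = Sg' → Q = P → E = Δ →
      ∀ J, TrD Sg' ev I J D → Fm.Atomic A → TrG ev J A)
    ?_ ?_ ?_ ?_ ?_ ?_ ?_ ?_ ?_ ?_ ?_ ?_ ?_ h rfl rfl rfl
  · rintro S Q E D A hA hD _ ih rfl rfl rfl _
    exact ih rfl rfl rfl I (hP D hD) hA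
  · intros; trivial
  · rintro S Q E G₁ G₂ _ _ ih1 ih2 rfl rfl rfl hG
    exact ⟨ih1 rfl rfl rfl hG.1, ih2 rfl rfl rfl hG.2⟩
  · rintro S Q E G₁ G₂ _ _ _ _ _ hG; exact hG.elim
  · rintro S Q E G₁ G₂ _ _ _ _ _ hG; exact hG.elim
  · rintro S Q E D G _ _ _ _ _ hG; exact hG.elim
  · rintro S Q E τ G c _ _ _ _ _ _ hG; exact hG.elim
  · rintro S Q E τ G N _ _ _ _ _ _ hG; exact hG.elim
  · rintro S Q E A A' hc _ _ _ J hD hA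
    rcases hA with rfl | ⟨p, Ms, rfl⟩
    · trivial
    · cases hc with
      | @atom _ _ Ns hc =>
        cases hD with
        | atom hD =>
          have : Ms.map ev = Ns.map ev := by
            clear hD
            induction hc with
            | nil => rfl
            | cons h _ ih => simp only [List.map]; rw [hev _ _ h, ih]
          simpa only [TrG, this] using hD
  · rintro S Q E G D A _ _ ih1 ih2 rfl rfl rfl J hD hA
    cases hD with
    | impl hG hD => exact ih1 rfl rfl rfl J (hD (ih2 rfl rfl rfl hG)) hA
  · rintro S Q E D₁ D₂ A _ ih rfl rfl rfl J hD hA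
    cases hD with
    | conj h1 h2 => exact ih rfl rfl rfl J h1 hA
  · rintro S Q E D₁ D₂ A _ ih rfl rfl rfl J hD hA
    cases hD with
    | conj h1 h2 => exact ih rfl rfl rfl J h2 hA
  · rintro S Q E τ D A N hN _ ih rfl rfl rfl J hD hA
    cases hD with
    | all h => exact ih rfl rfl rfl J (h N hN) hA

/-! ## Clauses -/

def Atm.sub (σ : ℕ → Tm) (A : Atm) : Atm := ⟨A.p, A.args.map (Tm.sub σ)⟩

theorem Atm.sub_sub (A : Atm) (σ σ' : ℕ → Tm) :
    (A.sub σ).sub σ' = A.sub (fun n => (σ n).sub σ') := by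
  simp [Atm.sub, tm_sub_sub]

theorem Atm.sub_var (A : Atm) : A.sub Tm.var = A := by
  have : (Tm.sub Tm.var) = id := by funext M; exact gs_id M
  simp [Atm.sub, this]

theorem subst_mkAll (m : ℕ) (φ : Fm) (N : Tm) : ∀ k, Fm.subst k N (mkAll m φ) = mkAll m (Fm.subst (k + m) N φ) := by
  induction m with
  | zero => intro k; rfl
  | succ m ih => intro k; simp only [mkAll, Fm.subst, ih]; rw [Nat.add_right_comm, Nat.add_assoc]

theorem subst_toFm (A : Atm) (k N) : Fm.subst k N A.toFm = (A.sub (sk k N)).toFm := by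
  simp only [Atm.toFm, Atm.sub, Fm.subst]
  congr 1
  refine List.map_congr_left fun M _ => subst_eq M k N

theorem subst_mkConj (As : List Atm) (k N) : Fm.subst k N (mkConj (As.map Atm.toFm)) =
    mkConj ((As.map (Atm.sub (sk k N))).map Atm.toFm) := by
  induction As with
  | nil => rfl
  | cons A As ih =>
    cases As with
    | nil => exact subst_toFm A k N
    | cons B As =>
      simp only [List.map, mkConj, Fm.subst] at ih ⊢
      rw [ih, subst_toFm]

def hform (As : List Atm) (A₀ : Atm) : Fm := .impl (mkConj (As.map Atm.toFm)) A₀.toFm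

theorem subst_hform (As A₀ k N) : Fm.subst k N (hform As A₀) =
    hform (As.map (Atm.sub (sk k N))) (A₀.sub (sk k N)) := by
  simp only [hform, Fm.subst, subst_mkConj, subst_toFm]

theorem hg_mkConj (As : List Atm) : HG (mkConj (As.map Atm.toFm)) := by
  induction As with
  | nil => trivial
  | cons A As ih =>
    cases As with
    | nil => trivial
    | cons B As => exact ⟨trivial, ih⟩

def Atm.evl {Sg : Sig} (ev : Tm → GCoTerm Sg) (A : Atm) : HBase Sg := (A.p, A.args.map ev)

theorem trG_mkConj {Sg : Sig} {ev : Tm → GCoTerm Sg} {I} (As : List Atm) :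
    TrG ev I (mkConj (As.map Atm.toFm)) ↔ ∀ A ∈ As, A.evl ev ∈ I := by
  induction As with
  | nil => simp [mkConj, TrG]
  | cons A As ih =>
    cases As with
    | nil => simp [mkConj, TrG, Atm.toFm, Atm.evl]
    | cons B As =>
      rw [List.forall_mem_cons, ← ih]
      rfl

theorem trD_mkConj {Sg : Sig} {Sg' : Sig} {ev : Tm → GCoTerm Sg} {I J} (As : List Atm)
    (h : ∀ A ∈ As, A.evl ev ∈ J) : TrD Sg' ev I J (mkConj (As.map Atm.toFm)) := by
  induction As with
  | nil => exact .top
  | cons A As ih =>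
    have hA : TrD Sg' ev I J A.toFm := .atom (h A (by simp))
    cases As with
    | nil => exact hA
    | cons B As => exact .conj hA (ih fun A hA => h A (by simp at hA ⊢; tauto))

theorem trD_mkAll {Sg : Sig} {Sg' : Sig} (hSg' : Sg'.FirstOrder) {ev : Tm → GCoTerm Sg} {I J} (m : ℕ) :
    ∀ (As : List Atm) (A₀ : Atm),
    (∀ σ : ℕ → Tm, (∀ i < m, GBase Sg' [] (σ i) .base) →
      (∀ A ∈ As, (A.sub σ).evl ev ∈ I) → (A₀.sub σ).evl ev ∈ J) →
    TrD Sg' ev I J (mkAll m (hform As A₀)) := by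
  induction m with
  | zero =>
    intro As A₀ h
    have := h Tm.var (by simp)
    simp only [Atm.sub_var] at this
    exact .impl (hg_mkConj As) fun hG => .atom (this ((trG_mkConj As).1 hG))
  | succ m ih =>
    intro As A₀ h
    refine .all fun N hN => ?_
    rw [subst_mkAll, subst_hform]
    refine ih _ _ ?_
    intro σ hσ hAs
    rw [Atm.sub_sub]
    refine h _ ?_ ?_
    · intro i hi
      simp only [sk]
      split_ifs with h1 h2
      · rw [Tm.sub, gs_ren]
        have e : ∀ σ', Tm.gs Tm.const σ' N = N := fun σ' => sub_closed (hN.hasTy hSg') σ'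
        rw [e]; exact hN
      · omega
      · exact hσ i (by omega)
    · intro A hA
      rw [← Atm.sub_sub]
      exact hAs _ (List.mem_map_of_mem hA)

theorem gua_mkAll {P Δ : Set Fm} (m : ℕ) : ∀ (As : List Atm) (A₀ : Atm) (Sg : Sig), Sg.FirstOrder →
    Gua Sg P Δ (mkAll m (hform As A₀)) →
    ∃ (Sg' : Sig) (cs : ℕ → String), Sg'.FirstOrder ∧
      (∀ i < m, Sg (cs i) = none) ∧ (∀ i < m, ∀ j < m, cs i = cs j → i = j) ∧
      (∀ c τ, Sg' c = some τ → Sg c = some τ ∨ ∃ i < m, c = cs i ∧ τ = .base) ∧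
      Gua Sg' P Δ (hform (As.map (Atm.sub fun i => if i < m then .const (cs i) else .var (i - m)))
        (A₀.sub fun i => if i < m then .const (cs i) else .var (i - m))) := by
  induction m with
  | zero =>
    intro As A₀ Sg hSg h
    refine ⟨Sg, fun _ => default, hSg, by simp, by simp, fun c τ h => .inl h, ?_⟩
    have e : (fun i => if i < 0 then Tm.const default else Tm.var (i - 0)) = Tm.var := by
      funext i; simp
    have e2 : Atm.sub Tm.var = id := by funext A; exact A.sub_var
    rw [e, e2]; simpa [mkAll] using h
  | succ m ih =>
    intro As A₀ Sg hSg h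
    cases h with
    | decideG hA _ _ => rcases hA with hA | ⟨p, Ms, hA⟩ <;> simp [mkAll] at hA
    | allRG c hc h =>
      rw [subst_mkAll, subst_hform] at h
      obtain ⟨Sg', cs, h1, h2, h3, h4, h5⟩ := ih _ _ _ (by
        intro d τ hd
        by_cases hdc : d = c
        · subst hdc; simp at hd; subst hd; simp [Ty.order]
        · rw [Function.update_of_ne hdc] at hd; exact hSg d τ hd) h
      have hne : ∀ i < m, cs i ≠ c := by
        intro i hi he
        have := h2 i hi
        rw [he] at this; simp at this
      refine ⟨Sg', fun i => if i = m then c else cs i, h1, ?_, ?_, ?_, ?_⟩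
      · intro i hi
        by_cases him : i = m
        · simpa [him] using hc
        · have hi' : i < m := by omega
          have := h2 i hi'
          rw [Function.update_of_ne (hne i hi')] at this
          simpa [him] using this
      · intro i hi j hj hij
        by_cases him : i = m <;> by_cases hjm : j = m
        · omega
        · simp [him, hjm] at hij; exact absurd hij.symm (hne j (by omega))
        · simp [him, hjm] at hij; exact absurd hij (hne i (by omega))
        · simp [him, hjm] at hij; exact h3 i (by omega) j (by omega) hij
      · intro d τ hd
        rcases h4 d τ hd with h | ⟨i, hi, h, h'⟩
        · by_cases hdc : d = c
          · subst hdc; simp at h; exact .inr ⟨m, by omega, by simp, h.symm⟩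
          · rw [Function.update_of_ne hdc] at h; exact .inl h
        · exact .inr ⟨i, by omega, by simp [hi.ne, h], h'⟩
      · have e : (fun i => (sk (0 + m) (.const c) i).sub
            (fun i => if i < m then .const (cs i) else .var (i - m))) =
            fun i => if i < m + 1 then Tm.const (if i = m then c else cs i) else .var (i - (m + 1)) := by
          funext i
          simp only [sk, Nat.zero_add]
          rcases lt_trichotomy i m with h | h | h
          · rw [if_neg h.ne, if_neg (by omega), if_pos (by omega), if_neg h.ne]
            simp [Tm.sub, Tm.gs, h]
          · subst h; simp [Tm.ren, Tm.sub, Tm.gs]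
          · rw [if_neg h.ne', if_pos h, if_neg (by omega)]
            simp only [Tm.sub, Tm.gs]
            rw [if_neg (by omega)]; congr 1; omega
        rw [← e]
        rw [List.map_map] at h5
        have e2 : ∀ σ σ', Atm.sub σ' ∘ Atm.sub σ = Atm.sub (fun n => (σ n).sub σ') := by
          intro σ σ'; funext A; exact A.sub_sub _ _
        rw [e2, Atm.sub_sub] at h5
        exact h5

theorem Atm.WFg.gt {Sg : Sig} {Pg : PSig} {n : ℕ} {A : Atm} (h : A.WFg Sg Pg n) :
    ∀ M ∈ A.args, GT Sg n .base M := by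
  obtain ⟨τs, hp, hb, h⟩ := h
  clear hp
  generalize A.args = Ms at h
  intro M hM
  induction h with
  | nil => simp at hM
  | cons h _ ih =>
    rcases List.mem_cons.1 hM with rfl | hM
    · have := hb _ (List.mem_cons_self ..)
      subst this; exact h
    · exact ih (fun τ hτ => hb τ (by simp [hτ])) hM

theorem trD_clause {Sg : Sig} {Pg : PSig} (hSg : Sg.FirstOrder) {sem : Tm → CoTerm Sg ℕ}
    (hsem : SemSpec Sg sem) {Sg' : Sig} (hSg' : Sg'.FirstOrder) {n : ℕ} {κ : String → Tm}
    (E : Eig Sg Sg' n κ) (θ : ℕ → GCoTerm Sg) {I J : Set (HBase Sg)} {C : HClause} (hC : C.WFg Sg Pg)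
    (h : ∀ θ' : ℕ → GCoTerm Sg, (∀ B ∈ C.body, B.gsem sem θ' ∈ I) → C.head.gsem sem θ' ∈ J) :
    TrD Sg' (fun M => csubst (sem (M.gs κ .var)) θ) I J C.toFm := by
  refine trD_mkAll hSg' C.n C.body C.head ?_
  intro σ hσ
  have key : ∀ A : Atm, A.WFg Sg Pg C.n →
      (A.sub σ).evl (fun M => csubst (sem (M.gs κ .var)) θ) =
        A.gsem sem (fun i => csubst (sem ((σ i).gs κ .var)) θ) := by
    intro A hA
    simp only [Atm.evl, Atm.sub, Atm.gsem, List.map_map]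
    congr 1
    refine List.map_congr_left fun M hM => ?_
    have hMg := hA.gt M hM
    have e : (M.sub σ).gs κ .var = M.sub (fun i => (σ i).gs κ .var) := by
      rw [Tm.sub, gs_gs]
      exact gs_congr hMg.2 (fun c τ hc => E.old c τ hc) (fun _ _ => rfl)
    simp only [Function.comp, e]
    exact kl' hSg hsem (fun i hi => eig_gtc hSg hSg' E (hσ i hi)) θ M hMg
  intro hB
  rw [key _ hC.1]
  refine h _ fun B hB' => ?_
  rw [← key _ (hC.2 B hB')]
  exact hB B hB'

theorem head_mem {Sg : Sig} {Pg : PSig} (hSg : Sg.FirstOrder) {sem : Tm → CoTerm Sg ℕ}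
    (hsem : SemSpec Sg sem) {P : Set HClause} (hP : ∀ C ∈ P, C.WFg Sg Pg)
    {C : HClause} (hC : C.WFg Sg Pg) (h : CUP Sg (HClause.toFm '' P) C.toFm)
    {I : Set (HBase Sg)} (hI : PhiP (insert C P) sem I ⊆ I) (θ : ℕ → GCoTerm Sg)
    (hb : ∀ B ∈ C.body, B.gsem sem θ ∈ I) : C.head.gsem sem θ ∈ PhiP P sem I := by
  classical
  obtain ⟨Sg', cs, hSg', hfresh, hinj, hext, hG⟩ := gua_mkAll C.n C.body C.head Sg hSg h
  let κ : String → Tm := fun c => if hc : ∃ i < C.n, c = cs i then .var hc.choose else .const c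
  have hκ : ∀ i < C.n, κ (cs i) = .var i := by
    intro i hi
    have hc : ∃ j < C.n, cs i = cs j := ⟨i, hi, rfl⟩
    simp only [κ, dif_pos hc]
    exact congrArg Tm.var (hinj i hi _ hc.choose_spec.1 hc.choose_spec.2).symm
  have E : Eig Sg Sg' C.n κ := by
    have old : ∀ c τ, Sg c = some τ → κ c = .const c := by
      intro c τ hc
      simp only [κ]
      rw [dif_neg]
      rintro ⟨i, hi, rfl⟩
      rw [hfresh i hi] at hc; simp at hc
    refine ⟨?_, old⟩
    intro c τ hc
    rcases hext c τ hc with h | ⟨i, hi, rfl, h⟩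
    · exact .inl ⟨old c τ h, h⟩
    · exact .inr ⟨i, hi, hκ i hi, h⟩
  let ev : Tm → GCoTerm Sg := fun M => csubst (sem (M.gs κ .var)) θ
  have hev : ∀ M N, Conv M N → ev M = ev N := fun M N c => by
    simp only [ev]; rw [hsem.1 _ _ (c.gs _ _)]
  let s : ℕ → Tm := fun i => if i < C.n then .const (cs i) else .var (i - C.n)
  have hA : ∀ A : Atm, A.WFg Sg Pg C.n → (A.sub s).evl ev = A.gsem sem θ := by
    intro A hA
    simp only [Atm.evl, Atm.sub, Atm.gsem, List.map_map]
    congr 1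
    refine List.map_congr_left fun M hM => ?_
    have e : (M.sub s).gs κ .var = M := by
      rw [Tm.sub, gs_gs]
      conv_rhs => rw [← gs_id M]
      refine gs_congr (hA.gt M hM).2 (fun c τ hc => E.old c τ hc) ?_
      intro i hi
      have hi : i < C.n := by simpa using hi
      simp only [s, if_pos hi]
      exact hκ i hi
    simp only [Function.comp, ev, e]
  rw [← hA _ hC.1]
  have hmono : PhiP P sem I ⊆ I := by
    rintro a ⟨D, hD, h⟩; exact hI ⟨D, .inr hD, h⟩
  have hPJ : ∀ D ∈ HClause.toFm '' P, TrD Sg' ev I (PhiP P sem I) D := by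
    rintro _ ⟨D, hD, rfl⟩
    exact trD_clause hSg hsem hSg' E θ (hP D hD) fun θ' hB => ⟨D, hD, θ', rfl, hB⟩
  cases hG with
  | decideG hA _ _ => rcases hA with hA | ⟨p, Ms, hA⟩ <;> simp [hform] at hA
  | implRG hG =>
    cases hG with
    | decideG hAt hD hF =>
      refine foc_sound hev (I := I) ?_ hF _ (hPJ _ hD) hAt
      rintro D (⟨D, hD, rfl⟩ | rfl | rfl)
      · exact trD_clause hSg hsem hSg' E θ (hP D hD) fun θ' hB => hI ⟨D, .inr hD, θ', rfl, hB⟩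
      · refine trD_mkConj _ ?_
        intro A hA'
        obtain ⟨B, hB, rfl⟩ := List.mem_map.1 hA'
        have := hb B hB
        rw [← hA _ (hC.2 B hB)] at this
        exact this
      · exact trD_clause hSg hsem hSg' E θ hC fun θ' hB => hI ⟨C, .inl rfl, θ', rfl, hB⟩


/-- **Conservativity of coinductively proven lemmas**: if `φ` is an
`H^g`-formula and `Σ; P ⊢co φ` is provable in CUP, then
`M(P ∪ {φ}) = M(P)`, i.e. `P ∪ {φ}` is a conservative extension of `P`
with respect to the complete Herbrand model. -/
theorem cup_conservative_extension (Sg : Sig) (Pg : PSig) (hSg : Sg.FirstOrder)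
    (sem : Tm → CoTerm Sg ℕ) (hsem : SemSpec Sg sem)
    (P : Set HClause) (hP : ∀ C ∈ P, C.WFg Sg Pg)
    (C : HClause) (hC : C.WFg Sg Pg)
    (h : CUP Sg (HClause.toFm '' P) C.toFm) :
    HModel (insert C P) sem = HModel P sem := by

  apply le_antisymm
  · refine OrderHom.le_gfp _ ?_
    set I := HModel (insert C P) sem with hIdef
    have hfix : PhiP (insert C P) sem I = I :=
      OrderHom.map_gfp ⟨PhiP (insert C P) sem, PhiP_mono (insert C P) sem⟩
    intro a ha
    rw [← hfix] at ha
    obtain ⟨D, hD, θ, rfl, hb⟩ := ha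
    rcases hD with rfl | hD
    · exact head_mem hSg hsem hP hC h hfix.le θ hb
    · exact ⟨D, hD, θ, rfl, hb⟩
  · refine OrderHom.le_gfp _ ?_
    have hfix : PhiP P sem (HModel P sem) = HModel P sem :=
      OrderHom.map_gfp ⟨PhiP P sem, PhiP_mono P sem⟩
    intro a ha
    rw [← hfix] at ha
    obtain ⟨D, hD, h⟩ := ha
    exact ⟨D, .inr hD, h⟩
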